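/- arXiv:2101.05762 — 16 statements merged into one kernel-verified Lean document; each statement's English description precedes it below -/
import Mathlib

section
/- Let X be a (b,n)-homogeneous metric space for some real b > 0 and integer n ≥ 2. Suppose Y is a metric space that is not (a,n)-homogeneous for some real a with 0 < a < b. Then 2·d_GH(X,Y) ≥ b − a, where d_GH denotes the Gromov–Hausdorff distance. -/
open Set Metric Real
open scoped ENNReal

/-- A correspondence between `X` and `Y`: a subset of `X × Y` whose projections
to both factors are surjective. -/
def IsCorrespondence (X Y : Type*) (R : Set (X × Y)) : Prop :=
  (∀ x : X, ∃ y : Y, (x, y) ∈ R) ∧ ∀ y : Y, ∃ x : X, (x, y) ∈ R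

/-- The distortion of a relation `R ⊆ X × Y`:
`sup { ||x₁x₂| − |y₁y₂|| : (x₁,y₁), (x₂,y₂) ∈ R }`. -/
noncomputable def corDistortion (X Y : Type*) [MetricSpace X] [MetricSpace Y]
    (R : Set (X × Y)) : ℝ≥0∞ :=
  ⨆ p ∈ R, ⨆ q ∈ R, ENNReal.ofReal |dist p.1 q.1 - dist p.2 q.2|

/-- The Gromov–Hausdorff distance between metric spaces `X` and `Y`:
half the infimum of distortions of correspondences between `X` and `Y`. -/
noncomputable def ghDist (X Y : Type*) [MetricSpace X] [MetricSpace Y] : ℝ≥0∞ :=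
  (⨅ R ∈ {R : Set (X × Y) | IsCorrespondence X Y R}, corDistortion X Y R) / 2

/-- `X` is `(b,n)`-homogeneous: every point of `X` belongs to some `b`-separated
`n`-point subset of `X`. -/
def IsHomogeneous (X : Type*) [MetricSpace X] (b : ℝ) (n : ℕ) : Prop :=
  ∀ x : X, ∃ S : Finset X, x ∈ S ∧ S.card = n ∧
    ∀ p ∈ S, ∀ q ∈ S, p ≠ q → b ≤ dist p q

/-- `X` is round: it is `(b,2)`-homogeneous for every `0 < b < diam X`. -/
def IsRound (X : Type*) [MetricSpace X] : Prop :=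
  ∀ b : ℝ, 0 < b → ENNReal.ofReal b < EMetric.diam (univ : Set X) →
    IsHomogeneous X b 2

/-- The nonlinearity degree of a metric space `X`:
`inf_{f ∈ Lip₁(X)} sup { |xy| − |f(x) − f(y)| : x, y ∈ X }`. -/
noncomputable def nonlinDeg (X : Type*) [MetricSpace X] : ℝ≥0∞ :=
  ⨅ f ∈ {f : X → ℝ | LipschitzWith 1 f},
    ⨆ x : X, ⨆ y : X, ENNReal.ofReal (dist x y - |f x - f y|)

theorem homogeneous_vs_nonhomogeneous {X Y : Type*} [MetricSpace X] [MetricSpace Y]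
    [Nonempty X] [Nonempty Y] {a b : ℝ} {n : ℕ}
    (hn : 2 ≤ n) (hb : 0 < b) (hX : IsHomogeneous X b n)
    (ha : 0 < a) (hab : a < b) (hY : ¬ IsHomogeneous Y a n) :
    ENNReal.ofReal (b - a) ≤ 2 * ghDist X Y := by
  have h2 : 2 * ghDist X Y
      = ⨅ R ∈ {R : Set (X × Y) | IsCorrespondence X Y R}, corDistortion X Y R := by
    unfold ghDist
    exact ENNReal.mul_div_cancel (by norm_num) (by norm_num)
  rw [h2]
  refine le_iInf₂ fun R hR => ?_
  by_contra hlt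
  rw [not_le] at hlt
  apply hY
  have key : ∀ p ∈ R, ∀ q ∈ R, |dist p.1 q.1 - dist p.2 q.2| < b - a := by
    intro p hp q hq
    have h1 : ENNReal.ofReal |dist p.1 q.1 - dist p.2 q.2| ≤ corDistortion X Y R := by
      unfold corDistortion
      exact le_trans
        (le_iSup₂ (f := fun q (_ : q ∈ R) =>
          ENNReal.ofReal |dist p.1 q.1 - dist p.2 q.2|) q hq)
        (le_iSup₂ (f := fun p (_ : p ∈ R) => ⨆ q ∈ R,
          ENNReal.ofReal |dist p.1 q.1 - dist p.2 q.2|) p hp)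
    exact (ENNReal.ofReal_lt_ofReal_iff (by linarith)).1 (lt_of_le_of_lt h1 hlt)
  classical
  intro y
  obtain ⟨hR1, hR2⟩ := hR
  obtain ⟨x, hx⟩ := hR2 y
  obtain ⟨S, hxS, hcard, hsep⟩ := hX x
  choose g hg using hR1
  let f : X → Y := fun z => if z = x then y else g z
  have hfx : f x = y := by simp [f]
  have hf : ∀ z, (z, f z) ∈ R := by
    intro z
    by_cases hz : z = x
    · rw [hz, hfx]; exact hx
    · simp only [f, if_neg hz]; exact hg z
  have hd : ∀ p ∈ S, ∀ q ∈ S, p ≠ q → a < dist (f p) (f q) := by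
    intro p hp q hq hpq
    have h1 := hsep p hp q hq hpq
    have h3 := (abs_lt.1 (key _ (hf p) _ (hf q))).2
    simp only at h3
    linarith
  refine ⟨S.image f, Finset.mem_image.2 ⟨x, hxS, hfx⟩, ?_, ?_⟩
  · rw [Finset.card_image_of_injOn, hcard]
    intro p hp q hq hpq
    by_contra hne
    have h1 := hd p hp q hq hne
    rw [hpq, dist_self] at h1
    linarith
  · intro p hp q hq hpq
    obtain ⟨u, hu, rfl⟩ := Finset.mem_image.1 hp
    obtain ⟨v, hv, rfl⟩ := Finset.mem_image.1 hq
    exact (hd u hu v hv (fun h => hpq (by rw [h]))).le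
end

section
/- Let X be a round metric space and let a satisfy 0 < a < diam X. Suppose the metric space Y is not (a,2)-homogeneous. Then 2·d_GH(X,Y) ≥ diam X − a. -/
open Set Metric Real
open scoped ENNReal

theorem round_vs_nonhomogeneous {X Y : Type*} [MetricSpace X] [MetricSpace Y]
    [Nonempty X] [Nonempty Y] (hX : IsRound X) {a : ℝ} (ha : 0 < a)
    (had : ENNReal.ofReal a < EMetric.diam (Set.univ : Set X))
    (hY : ¬ IsHomogeneous Y a 2) :
    EMetric.diam (Set.univ : Set X) - ENNReal.ofReal a ≤ 2 * ghDist X Y := by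
  classical
  unfold IsHomogeneous at hY
  push Not at hY
  obtain ⟨y, hy⟩ := hY
  have hlt : ∀ y' : Y, dist y y' < a := by
    intro y'
    by_contra h
    push Not at h
    have hne : y ≠ y' := by
      rintro rfl
      rw [dist_self] at h
      linarith
    obtain ⟨p, hp, q, hq, hpq, hd⟩ := hy {y, y'} (by simp) (Finset.card_pair hne)
    simp only [Finset.mem_insert, Finset.mem_singleton] at hp hq
    rcases hp with rfl | rfl <;> rcases hq with rfl | rfl
    · exact hpq rfl
    · linarith
    · rw [dist_comm] at hd
      linarith
    · exact hpq rfl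
  unfold ghDist
  rw [ENNReal.mul_div_cancel (by norm_num) (by norm_num)]
  refine le_iInf₂ fun R hR => ?_
  rw [tsub_le_iff_right]
  refine le_of_forall_lt_imp_le_of_dense fun c hc => ?_
  have hctop : c ≠ ⊤ := ne_top_of_lt hc
  by_cases hc0 : c = 0
  · simp [hc0]
  have hcb : ENNReal.ofReal c.toReal = c := ENNReal.ofReal_toReal hctop
  obtain ⟨x, hx⟩ := hR.2 y
  obtain ⟨S, hxS, hS2, hS⟩ := hX c.toReal (ENNReal.toReal_pos hc0 hctop) (by rwa [hcb]) x
  obtain ⟨x', hx'S, hne⟩ := Finset.exists_mem_ne (by omega : 1 < S.card) x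
  have hd := hS x hxS x' hx'S hne.symm
  obtain ⟨y', hy'⟩ := hR.1 x'
  have h1 : ENNReal.ofReal |dist x x' - dist y y'| ≤ corDistortion X Y R := by
    unfold corDistortion
    exact le_trans (le_iSup₂ (f := fun (q : X × Y) (_ : q ∈ R) =>
        ENNReal.ofReal |dist x q.1 - dist y q.2|) (x', y') hy')
      (le_iSup₂ (f := fun (p : X × Y) (_ : p ∈ R) =>
        ⨆ q ∈ R, ENNReal.ofReal |dist p.1 q.1 - dist p.2 q.2|) (x, y) hx)
  calc c = ENNReal.ofReal c.toReal := hcb.symm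
    _ ≤ ENNReal.ofReal (|dist x x' - dist y y'| + a) := by
        apply ENNReal.ofReal_le_ofReal
        have := hlt y'
        have := le_abs_self (dist x x' - dist y y')
        linarith
    _ = ENNReal.ofReal |dist x x' - dist y y'| + ENNReal.ofReal a :=
        ENNReal.ofReal_add (abs_nonneg _) ha.le
    _ ≤ _ := by gcongr
end

section
/- Let X ⊆ ℝⁿ be the sphere of radius r > 0 centered at some point, with respect to some norm on ℝⁿ (i.e., X = { x : ‖x − x₀‖ = r }), endowed with the metric induced by that norm. Then X is round, and X is not (a,2)-homogeneous for any a > 2r. -/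
open Set Metric Real
open scoped ENNReal

theorem sphere_is_round_and_not_homogeneous {E : Type*} [NormedAddCommGroup E]
    [NormedSpace ℝ E] [FiniteDimensional ℝ E] [Nontrivial E] (x₀ : E) {r : ℝ}
    (hr : 0 < r) :
    IsRound ↥(Metric.sphere x₀ r) ∧
      ∀ a : ℝ, 2 * r < a → ¬ IsHomogeneous ↥(Metric.sphere x₀ r) a 2 := by
  have hd : ∀ p q : ↥(Metric.sphere x₀ r), dist p q ≤ 2 * r := by
    intro p q
    have h1 : dist (p : E) x₀ = r := p.2
    have h2 : dist (q : E) x₀ = r := q.2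
    have h3 := dist_triangle_right (p : E) (q : E) x₀
    rw [Subtype.dist_eq]
    linarith
  refine ⟨?_, ?_⟩
  · intro b hb hbd x
    have hb2 : b ≤ 2 * r := by
      by_contra hcon
      push Not at hcon
      have h4 : EMetric.diam (univ : Set ↥(Metric.sphere x₀ r)) ≤ ENNReal.ofReal b := by
        apply EMetric.diam_le
        intro p _ q _
        rw [edist_dist]
        exact ENNReal.ofReal_le_ofReal ((hd p q).trans hcon.le)
      exact absurd hbd (not_lt.mpr h4)
    have hx : ‖(x : E) - x₀‖ = r := by
      have := x.2
      rwa [mem_sphere_iff_norm] at this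
    have hy : x₀ + (x₀ - (x : E)) ∈ Metric.sphere x₀ r := by
      rw [mem_sphere_iff_norm, add_sub_cancel_left, norm_sub_rev]
      exact hx
    have hxy : dist x (⟨_, hy⟩ : ↥(Metric.sphere x₀ r)) = 2 * r := by
      rw [Subtype.dist_eq, dist_eq_norm]
      have : (x : E) - (x₀ + (x₀ - (x : E))) = (2 : ℝ) • ((x : E) - x₀) := by
        rw [two_smul]; abel
      change ‖(x : E) - (x₀ + (x₀ - (x : E)))‖ = 2 * r
      rw [this, norm_smul, hx]
      norm_num
    have hne : x ≠ (⟨_, hy⟩ : ↥(Metric.sphere x₀ r)) := by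
      intro h
      have := dist_eq_zero.mpr h
      linarith
    classical
    refine ⟨{x, ⟨_, hy⟩}, by simp, Finset.card_pair hne, ?_⟩
    intro p hp q hq hpq
    rw [Finset.mem_insert, Finset.mem_singleton] at hp hq
    rcases hp with rfl | rfl <;> rcases hq with rfl | rfl
    · exact absurd rfl hpq
    · linarith
    · rw [dist_comm]; linarith
    · exact absurd rfl hpq
  · intro a ha hom
    obtain ⟨z, hz⟩ := (NormedSpace.sphere_nonempty (x := x₀) (r := r)).mpr hr.le
    obtain ⟨S, -, hS, hsep⟩ := hom ⟨z, hz⟩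
    obtain ⟨p, hp, q, hq, hpq⟩ := Finset.one_lt_card.mp (by omega : 1 < S.card)
    have := hsep p hp q hq hpq
    have := hd p q
    linarith
end

section
/- If X is a bounded metric space, then there exists a non-empty closed bounded subset Z ⊆ ℝ such that d_GH(X,Z) ≤ c(X)/2. -/
open Set Metric Real
open scoped ENNReal

theorem exists_min_nonlin (X : Type*) [MetricSpace X] [Nonempty X] [BoundedSpace X] :
    ∃ f : X → ℝ, LipschitzWith 1 f ∧
      (⨆ x : X, ⨆ y : X, ENNReal.ofReal (dist x y - |f x - f y|)) ≤ nonlinDeg X := by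
  obtain ⟨x0⟩ := ‹Nonempty X›
  let S : Set (X → ℝ) := {f | LipschitzWith 1 f} ∩ {f | f x0 = 0}
  have hclosed : IsClosed S :=
    (isClosed_setOfPred_lipschitzWith 1).inter (isClosed_eq (continuous_apply x0) continuous_const)
  have hcomp : IsCompact S := by
    refine (isCompact_univ_pi (s := fun x : X => Icc (-dist x x0) (dist x x0))
      (fun x => isCompact_Icc)).of_isClosed_subset hclosed ?_
    rintro f ⟨hf, hf0⟩ x -
    have h := hf.dist_le_mul x x0
    have hf0' : f x0 = 0 := hf0
    rw [Real.dist_eq, hf0'] at h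
    simp only [sub_zero, NNReal.coe_one, one_mul] at h
    exact abs_le.1 h
  have hne : S.Nonempty := ⟨fun _ => 0, LipschitzWith.const' 0 |>.weaken zero_le_one, rfl⟩
  have hlsc : LowerSemicontinuous (fun f : X → ℝ =>
      ⨆ x : X, ⨆ y : X, ENNReal.ofReal (dist x y - |f x - f y|)) := by
    refine lowerSemicontinuous_iSup fun x => lowerSemicontinuous_iSup fun y => ?_
    apply Continuous.lowerSemicontinuous
    apply ENNReal.continuous_ofReal.comp
    fun_prop
  obtain ⟨f, hfS, hmin⟩ := (hlsc.lowerSemicontinuousOn S).exists_isMinOn hne hcomp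
  refine ⟨f, hfS.1, ?_⟩
  refine le_iInf₂ fun g hg => ?_
  have hg' : LipschitzWith 1 g := hg
  have hgS : (fun x => g x - g x0) ∈ S := by
    refine ⟨LipschitzWith.of_dist_le_mul fun x y => ?_, sub_self _⟩
    simpa using hg'.dist_le_mul x y
  have := isMinOn_iff.1 hmin _ hgS
  simpa using this

theorem exists_closed_bounded_real_subset_ghDist_le (X : Type*) [MetricSpace X]
    [Nonempty X] [BoundedSpace X] :
    ∃ Z : Set ℝ, Z.Nonempty ∧ IsClosed Z ∧ Bornology.IsBounded Z ∧
      ghDist X ↥Z ≤ nonlinDeg X / 2 := by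
  obtain ⟨f, hf, hmin⟩ := exists_min_nonlin X
  have hf1 : ∀ x y, |f x - f y| ≤ dist x y := fun x y => by
    simpa [Real.dist_eq] using hf.dist_le_mul x y
  refine ⟨closure (range f), (range_nonempty f).closure, isClosed_closure, ?_, ?_⟩
  · refine Bornology.IsBounded.closure ?_
    rw [← image_univ]
    exact hf.isBounded_image (Bornology.IsBounded.all _)
  unfold ghDist
  refine ENNReal.div_le_div_right (le_trans ?_ hmin) 2
  refine ENNReal.le_of_forall_pos_le_add fun ε hε _ => ?_
  have hε' : (0 : ℝ) < ε := hε
  refine iInf₂_le_of_le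
    {p : X × ↥(closure (range f)) | |f p.1 - (p.2 : ℝ)| < ε / 2} ⟨?_, ?_⟩ ?_
  · intro x
    refine ⟨⟨f x, subset_closure (mem_range_self x)⟩, ?_⟩
    simpa using hε'
  · rintro ⟨z, hz⟩
    obtain ⟨_, ⟨x, rfl⟩, hx⟩ := Metric.mem_closure_iff.1 hz (ε / 2) (by positivity)
    refine ⟨x, ?_⟩
    rw [dist_comm, Real.dist_eq] at hx
    exact hx
  · refine iSup₂_le fun p hp => iSup₂_le fun q hq => ?_
    have hp' : |f p.1 - (p.2 : ℝ)| < ε / 2 := hp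
    have hq' : |f q.1 - (q.2 : ℝ)| < ε / 2 := hq
    have hle : |dist p.1 q.1 - dist p.2 q.2| ≤ (dist p.1 q.1 - |f p.1 - f q.1|) + ε := by
      have h := hf1 p.1 q.1
      have h2 : |(|f p.1 - f q.1| - |(p.2 : ℝ) - q.2|)| ≤ ε := by
        refine (abs_abs_sub_abs_le_abs_sub _ _).trans ?_
        rw [abs_lt] at hp' hq'
        rw [abs_le]
        constructor <;> linarith
      rw [Subtype.dist_eq, Real.dist_eq]
      rw [abs_le] at h2 ⊢
      constructor <;> linarith
    calc ENNReal.ofReal |dist p.1 q.1 - dist p.2 q.2|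
        ≤ ENNReal.ofReal ((dist p.1 q.1 - |f p.1 - f q.1|) + ε) := ENNReal.ofReal_le_ofReal hle
      _ ≤ ENNReal.ofReal (dist p.1 q.1 - |f p.1 - f q.1|) + ENNReal.ofReal ε :=
          ENNReal.ofReal_add_le
      _ ≤ _ := by
          rw [ENNReal.ofReal_coe_nnreal]
          gcongr
          exact le_iSup₂ (f := fun x y => ENNReal.ofReal (dist x y - |f x - f y|)) p.1 q.1
end

section
/- Every compact metric space X with nonlinearity degree c(X) = 0 is isometric to a compact subset of ℝ. -/
open Set Metric Real
open scoped ENNReal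

theorem compact_nonlinDeg_zero_isometric_to_real_subset (X : Type*) [MetricSpace X]
    [CompactSpace X] [Nonempty X] (h : nonlinDeg X = 0) :
    ∃ Z : Set ℝ, IsCompact Z ∧ Nonempty (X ≃ᵢ ↥Z) := by
  obtain ⟨x0⟩ := ‹Nonempty X›
  have key : ∀ ε : ℝ, 0 < ε → ∃ f : X → ℝ, f x0 = 0 ∧ ∀ x y, |f x - f y| ≤ dist x y ∧
      dist x y - |f x - f y| ≤ ε := by
    intro ε hε
    have h1 : nonlinDeg X < ENNReal.ofReal ε := by
      rw [h]; exact ENNReal.ofReal_pos.2 hε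
    unfold nonlinDeg at h1
    simp only [iInf_lt_iff] at h1
    obtain ⟨f, hf, hlt⟩ := h1
    refine ⟨fun x => f x - f x0, by simp, fun x y => ?_⟩
    have e : f x - f x0 - (f y - f x0) = f x - f y := by ring
    simp only [e]
    constructor
    · have := LipschitzWith.dist_le_mul hf x y
      simpa [Real.dist_eq] using this
    · have h2 : ENNReal.ofReal (dist x y - |f x - f y|) ≤ ENNReal.ofReal ε :=
        (le_iSup₂ (f := fun x y => ENNReal.ofReal (dist x y - |f x - f y|)) x y).trans hlt.le
      exact (ENNReal.ofReal_le_ofReal_iff hε.le).1 h2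
  let K : ℕ → Set (X → ℝ) := fun n => {f | f x0 = 0 ∧ ∀ x y, |f x - f y| ≤ dist x y ∧
      dist x y - |f x - f y| ≤ 1 / ((n : ℝ) + 1)}
  have hcl : ∀ n, IsClosed (K n) := by
    intro n
    have : K n = {f | f x0 = 0} ∩ ⋂ x, ⋂ y, ({f : X → ℝ | |f x - f y| ≤ dist x y} ∩
      {f : X → ℝ | dist x y - |f x - f y| ≤ 1 / ((n : ℝ) + 1)}) := by
      ext f; simp [K]
    rw [this]
    refine (isClosed_eq (by fun_prop) (by fun_prop)).inter
      (isClosed_iInter fun x => isClosed_iInter fun y => ?_)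
    exact (isClosed_le (by fun_prop) (by fun_prop)).inter (isClosed_le (by fun_prop) (by fun_prop))
  have hK0 : IsCompact (K 0) := by
    refine (isCompact_univ_pi (fun x : X => isCompact_Icc (a := -dist x x0)
      (b := dist x x0))).of_isClosed_subset (hcl 0) ?_
    intro f hf x _
    have := (hf.2 x x0).1
    rw [hf.1, sub_zero] at this
    exact abs_le.1 this
  have hne := IsCompact.nonempty_iInter_of_sequence_nonempty_isCompact_isClosed K
    (by
      intro n f hf
      refine ⟨hf.1, fun x y => ⟨(hf.2 x y).1, (hf.2 x y).2.trans ?_⟩⟩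
      apply one_div_le_one_div_of_le (by positivity)
      push_cast; linarith)
    (fun n => key _ (by positivity)) hK0 hcl
  obtain ⟨f, hf⟩ := hne
  rw [mem_iInter] at hf
  have hiso : Isometry f := by
    refine Isometry.of_dist_eq fun x y => ?_
    rw [Real.dist_eq]
    refine le_antisymm ((hf 0).2 x y).1 ?_
    have : dist x y - |f x - f y| ≤ 0 :=
      ge_of_tendsto' tendsto_one_div_add_atTop_nhds_zero_nat fun n => ((hf n).2 x y).2
    linarith
  exact ⟨range f, isCompact_range hiso.continuous, ⟨hiso.isometryEquivOnRange⟩⟩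
end

section
/- For every compact metric space X there exists a 1-Lipschitz function f : X → ℝ attaining the nonlinearity degree, i.e., such that sup{ |xy| − |f(x) − f(y)| : x, y ∈ X } = c(X). -/
open Set Metric Real
open scoped ENNReal

theorem exists_lipschitz_attaining_nonlinDeg (X : Type*) [MetricSpace X]
    [CompactSpace X] [Nonempty X] :
    ∃ f : X → ℝ, LipschitzWith 1 f ∧
      (⨆ x : X, ⨆ y : X, ENNReal.ofReal (dist x y - |f x - f y|)) = nonlinDeg X := by
  classical
  obtain ⟨x0⟩ := ‹Nonempty X›
  let F : (X → ℝ) → ℝ≥0∞ := fun f =>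
    ⨆ x : X, ⨆ y : X, ENNReal.ofReal (dist x y - |f x - f y|)
  have hF : LowerSemicontinuous F := by
    refine lowerSemicontinuous_iSup fun x => lowerSemicontinuous_iSup fun y => ?_
    refine Continuous.lowerSemicontinuous ?_
    exact ENNReal.continuous_ofReal.comp (by fun_prop)
  let P : Set (X → ℝ) := Set.univ.pi fun x => Set.Icc (-dist x x0) (dist x x0)
  have hP : IsCompact P := isCompact_univ_pi fun x => isCompact_Icc
  let L : Set (X → ℝ) := {f | ∀ x y, |f x - f y| ≤ dist x y}
  have hL : IsClosed L := by
    have : L = ⋂ x, ⋂ y, {f : X → ℝ | |f x - f y| ≤ dist x y} := by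
      ext f; simp [L]
    rw [this]
    exact isClosed_iInter fun x => isClosed_iInter fun y =>
      isClosed_le (by fun_prop) continuous_const
  have hLip : ∀ f : X → ℝ, LipschitzWith 1 f ↔ f ∈ L := by
    intro f
    rw [lipschitzWith_iff_dist_le_mul]
    simp [L, Real.dist_eq]
  have hK : IsCompact (P ∩ L) := hP.inter_right hL
  have hne : (P ∩ L).Nonempty := by
    refine ⟨fun _ => 0, ?_, ?_⟩
    · intro x _
      simp
    · intro x y
      simp
  obtain ⟨f, hf, hmin⟩ := (hF.lowerSemicontinuousOn (P ∩ L)).exists_isMinOn hne hK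
  refine ⟨f, (hLip f).2 hf.2, ?_⟩
  apply le_antisymm
  · unfold nonlinDeg
    refine le_iInf₂ fun g hg => ?_
    have hgL : g ∈ L := (hLip g).1 hg
    have hmem : (fun x => g x - g x0) ∈ P ∩ L := by
      refine ⟨fun x _ => ?_, fun x y => ?_⟩
      · exact abs_le.1 (hgL x x0)
      · simpa using hgL x y
    have h := hmin hmem
    simpa [F] using h
  · unfold nonlinDeg
    exact iInf₂_le f ((hLip f).2 hf.2)
end

section
/- Let X be a connected compact metric space equipped with a homeomorphism α : X → X of order 2 (α ∘ α = id, α ≠ id) such that dist(α(x), x) = diam X for every x ∈ X, and let Y be a compact metric space with c(Y) < diam X. Then 2·d_GH(X,Y) ≥ (2/3)·(diam X − c(Y)). -/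
open Set Metric Real
open scoped ENNReal

theorem core_aux (X Y : Type*) [MetricSpace X] [ConnectedSpace X] [MetricSpace Y]
    (α : X ≃ₜ X) (hα2 : ∀ x, α (α x) = x) (D δ c : ℝ)
    (hαd : ∀ x : X, dist (α x) x = D) (y : X → Y)
    (hy : ∀ a b : X, |dist a b - dist (y a) (y b)| ≤ δ)
    (f : Y → ℝ) (hf : ∀ a b, |f a - f b| ≤ dist a b)
    (hc : ∀ a b, dist a b - |f a - f b| ≤ c) : 2 * (D - c) ≤ 3 * δ := by
  by_contra! hlt
  have hδ : 0 ≤ δ := by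
    obtain ⟨x⟩ := (inferInstance : Nonempty X)
    exact (abs_nonneg _).trans (hy x x)
  have hm : 0 < D - δ - c := by linarith
  have key : ∀ a b : X, dist a b - δ - c ≤ |f (y a) - f (y b)| := by
    intro a b
    have h1 := (abs_le.1 (hy a b)).2
    have h2 := hc (y a) (y b)
    linarith
  have up : ∀ a b : X, |f (y a) - f (y b)| ≤ dist a b + δ := by
    intro a b
    have h1 := (abs_le.1 (hy a b)).1
    have h2 := hf (y a) (y b)
    linarith
  have keyα : ∀ a : X, D - δ - c ≤ |f (y a) - f (y (α a))| := by
    intro a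
    have h := key a (α a)
    rw [dist_comm, hαd] at h
    exact h
  let A : Set X := {x | f (y (α x)) < f (y x)}
  have hAc : ∀ x, x ∉ A → α x ∈ A := by
    intro x hx
    have h := keyα x
    simp only [A, Set.mem_setOf_eq, not_lt, hα2] at hx ⊢
    rcases hx.lt_or_eq with h' | h'
    · exact h'
    · rw [h', sub_self, abs_zero] at h; linarith
  have hAc' : ∀ x, x ∈ A → α x ∉ A := by
    intro x hx
    simp only [A, Set.mem_setOf_eq, not_lt, hα2] at hx ⊢
    exact hx.le
  have hfr : (frontier A).Nonempty := by
    rw [nonempty_frontier_iff]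
    obtain ⟨x⟩ := (inferInstance : Nonempty X)
    by_cases hx : x ∈ A
    · exact ⟨⟨x, hx⟩, fun h => hAc' x hx (h ▸ Set.mem_univ _)⟩
    · exact ⟨⟨_, hAc x hx⟩, fun h => hx (h ▸ Set.mem_univ _)⟩
  obtain ⟨p, hp⟩ := hfr
  rw [frontier_eq_closure_inter_closure] at hp
  obtain ⟨e, he, he2⟩ : ∃ e : ℝ, 0 < e ∧ 8 * e < 2 * (D - c) - 3 * δ :=
    ⟨(2 * (D - c) - 3 * δ) / 16, by linarith, by linarith⟩
  have hU : {x | dist x p < e ∧ dist (α x) (α p) < e} ∈ nhds p := by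
    refine Filter.inter_mem (Metric.ball_mem_nhds p he) ?_
    exact α.continuous.continuousAt (Metric.ball_mem_nhds (α p) he)
  obtain ⟨x, ⟨hx1, hx2⟩, hxA⟩ := mem_closure_iff_nhds.1 hp.1 _ hU
  obtain ⟨x', ⟨hx1', hx2'⟩, hxA'⟩ := mem_closure_iff_nhds.1 hp.2 _ hU
  have d1 : dist x x' ≤ 2 * e := by
    have := dist_triangle_right x x' p
    linarith
  have d2 : dist (α x) (α x') ≤ 2 * e := by
    have := dist_triangle_right (α x) (α x') (α p)
    linarith
  have d3 : D - 2 * e ≤ dist x (α x') := by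
    have h1 := hαd x
    have h2 := dist_triangle_right (α x) x (α x')
    linarith
  have k1 := keyα x
  have k2 := keyα x'
  have k3 := key x (α x')
  have u1 := (abs_le.1 (up x x')).2
  have u2 := (abs_le.1 (up (α x) (α x'))).1
  have s1 : f (y (α x)) < f (y x) := hxA
  have s2 : f (y x') ≤ f (y (α x')) := not_lt.1 hxA'
  rw [abs_of_pos (by linarith)] at k1
  rw [abs_of_nonpos (by linarith)] at k2
  rcases le_abs.1 k3 with h | h <;> linarith

theorem ghDist_ge_of_involution_and_nonlinDeg (X Y : Type*) [MetricSpace X]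
    [CompactSpace X] [ConnectedSpace X] [Nonempty X]
    [MetricSpace Y] [CompactSpace Y] [Nonempty Y]
    (α : X ≃ₜ X) (hα2 : ∀ x, α (α x) = x) (hαid : ∃ x, α x ≠ x)
    (hαd : ∀ x : X, dist (α x) x = Metric.diam (Set.univ : Set X))
    (hc : nonlinDeg Y < ENNReal.ofReal (Metric.diam (Set.univ : Set X))) :
    2 / 3 * (ENNReal.ofReal (Metric.diam (Set.univ : Set X)) - nonlinDeg Y)
      ≤ 2 * ghDist X Y := by
  have h2 : 2 * ghDist X Y =
      ⨅ R ∈ {R : Set (X × Y) | IsCorrespondence X Y R}, corDistortion X Y R := by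
    unfold ghDist
    exact ENNReal.mul_div_cancel (by norm_num) (by norm_num)
  rw [h2]
  refine le_iInf₂ fun R hR => ?_
  have hR' : IsCorrespondence X Y R := hR
  set D := Metric.diam (Set.univ : Set X) with hD
  by_contra! hlt
  have hcfin : nonlinDeg Y ≠ ⊤ := (hc.trans ENNReal.ofReal_lt_top).ne
  have hdfin : corDistortion X Y R ≠ ⊤ := hlt.ne_top
  obtain ⟨c, hcc⟩ : ∃ c, c = (nonlinDeg Y).toReal := ⟨_, rfl⟩
  obtain ⟨δ, hδδ⟩ : ∃ δ, δ = (corDistortion X Y R).toReal := ⟨_, rfl⟩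
  have hc0 : 0 ≤ c := hcc ▸ ENNReal.toReal_nonneg
  have hcE : nonlinDeg Y = ENNReal.ofReal c := by rw [hcc, ENNReal.ofReal_toReal hcfin]
  have hlt' : δ < 2 / 3 * (D - c) := by
    have h := (ENNReal.toReal_lt_toReal hdfin
      (ENNReal.mul_ne_top (by finiteness) (by finiteness))).2 hlt
    rw [ENNReal.toReal_mul, ENNReal.toReal_sub_of_le hc.le ENNReal.ofReal_ne_top,
      ENNReal.toReal_ofReal Metric.diam_nonneg, ← hcc, ← hδδ] at h
    simpa using h
  obtain ⟨c', h1, h3⟩ : ∃ c' : ℝ, c < c' ∧ δ < 2 / 3 * (D - c') :=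
    ⟨(c + (D - 3 / 2 * δ)) / 2, by linarith, by linarith⟩
  have hclt : nonlinDeg Y < ENNReal.ofReal c' := by
    rw [hcE]; exact (ENNReal.ofReal_lt_ofReal_iff (by linarith)).2 h1
  unfold nonlinDeg at hclt
  simp only [iInf_lt_iff] at hclt
  obtain ⟨f, hf, hfc⟩ := hclt
  have hf' : LipschitzWith 1 f := hf
  choose y hy using hR'.1
  have := core_aux X Y α hα2 D δ c' hαd y ?_ f ?_ ?_
  · linarith
  · intro a b
    rw [hδδ, ← ENNReal.ofReal_le_iff_le_toReal hdfin]
    unfold corDistortion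
    exact le_iSup₂_of_le (a, y a) (hy a) (le_iSup₂_of_le (b, y b) (hy b) le_rfl)
  · intro a b
    have := hf'.dist_le_mul a b
    simpa [Real.dist_eq] using this
  · intro a b
    have h := (le_iSup₂ (f := fun x y => ENNReal.ofReal (dist x y - |f x - f y|)) a b).trans hfc.le
    exact (ENNReal.ofReal_le_ofReal_iff (by linarith)).1 h
end

section
/- Let S¹ be the unit circle { (x,y) ∈ ℝ² : x² + y² = 1 } endowed with its intrinsic (arc-length) metric. Then the nonlinearity degree satisfies c(S¹) ≥ π. More precisely, for every 1-Lipschitz function f : S¹ → ℝ one has sup{ dist(x,y) − |f(x) − f(y)| : x, y ∈ S¹ } ≥ π. -/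
open Set Metric Real
open scoped ENNReal

theorem circle_aux (f : AddCircle (2 * π) → ℝ) (hf : LipschitzWith 1 f) :
    ENNReal.ofReal π ≤
      ⨆ x : AddCircle (2 * π), ⨆ y : AddCircle (2 * π),
        ENNReal.ofReal (dist x y - |f x - f y|) := by
  have hc : Continuous f := hf.continuous
  have hmk : Continuous (fun t : ℝ => (t : AddCircle (2 * π))) :=
    AddCircle.continuous_mk' (2 * π)
  let g : ℝ → ℝ := fun t => f (t : AddCircle (2 * π)) - f ((t + π : ℝ) : AddCircle (2 * π))
  have hg : Continuous g :=
    (hc.comp hmk).sub (hc.comp (hmk.comp (continuous_id.add continuous_const)))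
  have h2 : ((π + π : ℝ) : AddCircle (2 * π)) = ((0 : ℝ) : AddCircle (2 * π)) := by
    rw [← two_mul, AddCircle.coe_period]; rfl
  have hs : g π = - g 0 := by
    simp only [g, h2, zero_add]; ring
  have hz : ∃ t, g t = 0 := by
    rcases le_total (g 0) 0 with h | h
    · exact mem_range_of_exists_le_of_exists_ge hg ⟨0, h⟩ ⟨π, by rw [hs]; linarith⟩
    · exact mem_range_of_exists_le_of_exists_ge hg ⟨π, by rw [hs]; linarith⟩ ⟨0, h⟩
  obtain ⟨t, ht⟩ := hz
  have hd : dist ((t + π : ℝ) : AddCircle (2 * π)) (t : AddCircle (2 * π)) = π := by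
    rw [dist_eq_norm, ← AddCircle.coe_sub, add_sub_cancel_left]
    have := AddCircle.norm_half_period_eq (2 * π)
    rw [mul_div_cancel_left₀ π (two_ne_zero), abs_of_pos (by positivity)] at this
    rw [this]; ring
  refine le_iSup_of_le (t : AddCircle (2 * π))
    (le_iSup_of_le ((t + π : ℝ) : AddCircle (2 * π)) ?_)
  have ht' : f (t : AddCircle (2 * π)) - f ((t + π : ℝ) : AddCircle (2 * π)) = 0 := ht
  rw [ht', dist_comm, hd, abs_zero, sub_zero]

theorem nonlinDeg_circle_ge_pi :
    ENNReal.ofReal π ≤ nonlinDeg (AddCircle (2 * π)) ∧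
      ∀ f : AddCircle (2 * π) → ℝ, LipschitzWith 1 f →
        ENNReal.ofReal π ≤
          ⨆ x : AddCircle (2 * π), ⨆ y : AddCircle (2 * π),
            ENNReal.ofReal (dist x y - |f x - f y|) := by
  exact ⟨le_iInf₂ fun f hf => circle_aux f hf, circle_aux⟩
end

section
/- Let S¹ be the unit circle with intrinsic metric and I_λ = [0,λ] ⊆ ℝ a segment of length λ. For every λ with 0 ≤ λ < π, the Gromov–Hausdorff distance satisfies d_GH(I_λ, S¹) ≥ π/2 − λ/4. -/
open Set Metric Real
open scoped ENNReal

lemma circle_no_small_distortion {lam d : ℝ} (hd : d < π - lam / 2)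
    (f : AddCircle (2 * π) → ℝ) (hf : ∀ y, 0 ≤ f y ∧ f y ≤ lam)
    (hdis : ∀ y z, dist y z - d ≤ |f y - f z|) : False := by
  have : Fact (0 < 2 * π) := ⟨by positivity⟩
  set h : AddCircle (2 * π) := ((π : ℝ) : AddCircle (2 * π)) with hh
  have hhn : ‖h‖ = π := by
    have := AddCircle.norm_half_period_eq (2 * π)
    rw [show 2 * π / 2 = π by ring, abs_of_pos (by positivity)] at this
    rw [hh, this]; ring
  have hh2 : h + h = 0 := by
    rw [hh, ← AddCircle.coe_add, ← two_mul]
    exact AddCircle.coe_period _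
  have hanti : ∀ y, dist y (y + h) = π := by
    intro y
    rw [dist_eq_norm, show y - (y + h) = -h by abel, norm_neg, hhn]
  have key : ∀ y z, dist y z < π - lam / 2 - d → lam / 2 < f y → lam / 2 < f z := by
    intro y z hyz hy
    by_contra hz
    push Not at hz
    have h1 := hdis y (y + h)
    have h2 := hdis z (z + h)
    rw [hanti] at h1 h2
    have h3 := hdis y (z + h)
    have h4 := dist_triangle z y (z + h)
    rw [hanti, dist_comm z y] at h4
    have b1 := hf y
    have b2 := hf z
    have b3 := hf (y + h)
    have b4 := hf (z + h)
    rcases abs_cases (f y - f (y + h)) with c1 | c1 <;>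
    rcases abs_cases (f z - f (z + h)) with c2 | c2 <;>
    rcases abs_cases (f y - f (z + h)) with c3 | c3 <;> linarith
  have hη : 0 < π - lam / 2 - d := by linarith
  have hclopen : IsClopen {y | lam / 2 < f y} := by
    constructor
    · rw [← isOpen_compl_iff, Metric.isOpen_iff]
      intro y hy
      refine ⟨_, hη, fun z hz hz' => hy (key z y ?_ hz')⟩
      exact hz
    · rw [Metric.isOpen_iff]
      intro y hy
      refine ⟨_, hη, fun z hz => key y z ?_ hy⟩
      rw [dist_comm]; exact hz
  have h1 := hdis 0 (0 + h)
  rw [hanti] at h1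
  have b1 := hf 0
  have b2 := hf (0 + h)
  rcases isClopen_iff.1 hclopen with e | e
  · have m1 : (0 : AddCircle (2 * π)) ∉ {y | lam / 2 < f y} := by rw [e]; simp
    have m2 : (0 + h : AddCircle (2 * π)) ∉ {y | lam / 2 < f y} := by rw [e]; simp
    simp only [mem_ofPred_eq, not_lt] at m1 m2
    rcases abs_cases (f 0 - f (0 + h)) with c1 | c1 <;> linarith
  · have m1 : (0 : AddCircle (2 * π)) ∈ {y | lam / 2 < f y} := by rw [e]; simp
    have m2 : (0 + h : AddCircle (2 * π)) ∈ {y | lam / 2 < f y} := by rw [e]; simp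
    simp only [mem_ofPred_eq] at m1 m2
    rcases abs_cases (f 0 - f (0 + h)) with c1 | c1 <;> linarith

theorem ghDist_segment_circle_lower_bound {lam : ℝ} (h0 : 0 ≤ lam) (hl : lam < π) :
    ENNReal.ofReal (π / 2 - lam / 4) ≤ ghDist ↥(Set.Icc (0:ℝ) lam) (AddCircle (2 * π)) := by
  unfold ghDist
  rw [show π / 2 - lam / 4 = (π - lam / 2) / 2 by ring,
    ENNReal.ofReal_div_of_pos (by norm_num), ENNReal.ofReal_ofNat]
  refine ENNReal.div_le_div_right ?_ _
  refine le_iInf₂ fun R hR => ?_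
  by_contra hlt
  push Not at hlt
  have hne : corDistortion _ _ R ≠ ⊤ := (hlt.trans ENNReal.ofReal_lt_top).ne
  choose f hf using hR.2
  refine circle_no_small_distortion (lam := lam) (d := (corDistortion _ _ R).toReal) ?_
    (fun y => (f y : ℝ)) (fun y => (f y).2) ?_
  · exact (ENNReal.lt_ofReal_iff_toReal_lt hne).1 hlt
  · intro y z
    have h1 : ENNReal.ofReal |dist (f y) (f z) - dist y z| ≤ corDistortion _ _ R := by
      unfold corDistortion
      exact le_iSup₂_of_le (f y, y) (hf y) (le_iSup₂_of_le (f z, z) (hf z) le_rfl)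
    have h2 := (ENNReal.ofReal_le_iff_le_toReal hne).1 h1
    have h3 := (abs_le.1 h2).1
    rw [Subtype.dist_eq, Real.dist_eq] at h3
    linarith
end

section
/- Let S¹ be the unit circle with intrinsic metric and I_λ = [0,λ] ⊆ ℝ. For every λ with 0 ≤ λ ≤ 2π/3, the Gromov–Hausdorff distance equals d_GH(I_λ, S¹) = π/2 − λ/4. -/
open Set Metric Real
open scoped ENNReal

theorem ghDist_segment_circle_small {lam : ℝ} (h0 : 0 ≤ lam)
    (hl : lam ≤ 2 * π / 3) :
    ghDist ↥(Set.Icc (0:ℝ) lam) (AddCircle (2 * π)) = ENNReal.ofReal (π / 2 - lam / 4) := by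
  have hpi := Real.pi_pos
  have key : (⨅ R ∈ {R : Set (↥(Set.Icc (0:ℝ) lam) × AddCircle (2 * π)) |
      IsCorrespondence ↥(Set.Icc (0:ℝ) lam) (AddCircle (2 * π)) R},
      corDistortion ↥(Set.Icc (0:ℝ) lam) (AddCircle (2 * π)) R)
      = ENNReal.ofReal (π - lam / 2) := by
    apply le_antisymm
    · have hmem : ∀ s ∈ Set.Icc (0:ℝ) (2 * π), lam * (s / (2 * π)) ∈ Set.Icc (0:ℝ) lam := by
        intro s hs
        have h1 : 0 ≤ s / (2 * π) := div_nonneg hs.1 (by positivity)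
        have h2 : s / (2 * π) ≤ 1 := by
          rw [div_le_one (by positivity)]
          exact hs.2
        exact ⟨mul_nonneg h0 h1, mul_le_of_le_one_right h0 h2⟩
      let R : Set (↥(Set.Icc (0:ℝ) lam) × AddCircle (2 * π)) :=
        {p | ∃ s ∈ Set.Icc (0:ℝ) (2 * π), (p.1 : ℝ) = lam * (s / (2 * π)) ∧ p.2 = (s : AddCircle (2 * π))}
      have hR : IsCorrespondence ↥(Set.Icc (0:ℝ) lam) (AddCircle (2 * π)) R := by
        constructor
        · rintro ⟨x, hx0, hx1⟩
          by_cases hlam : lam = 0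
          · refine ⟨((0:ℝ) : AddCircle (2 * π)), 0, ⟨le_rfl, by positivity⟩, ?_, rfl⟩
            simp only
            subst hlam
            linarith
          · have hlp : 0 < lam := lt_of_le_of_ne h0 (Ne.symm hlam)
            refine ⟨((x / lam * (2 * π) : ℝ) : AddCircle (2 * π)), x / lam * (2 * π), ⟨by positivity, ?_⟩, ?_, rfl⟩
            · have : x / lam ≤ 1 := by
                rw [div_le_one hlp]
                exact hx1
              nlinarith
            · simp only
              field_simp
        · intro y
          haveI : Fact (0 < 2 * π) := ⟨by positivity⟩
          obtain ⟨s, hs, rfl⟩ : ∃ s ∈ Set.Ico (0:ℝ) (0 + 2 * π), (s : AddCircle (2 * π)) = y := by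
            have := AddCircle.coe_image_Ico_eq (2 * π) 0
            have hy : y ∈ (Set.univ : Set (AddCircle (2 * π))) := trivial
            rw [← this] at hy
            exact hy
          have hs' : s ∈ Set.Icc (0:ℝ) (2 * π) := ⟨hs.1, by linarith [hs.2]⟩
          exact ⟨⟨_, hmem s hs'⟩, s, hs', rfl, rfl⟩
      refine (iInf₂_le R hR).trans ?_
      unfold corDistortion
      refine iSup₂_le fun p hp => iSup₂_le fun q hq => ENNReal.ofReal_le_ofReal ?_
      obtain ⟨s, hs, hs1, hs2⟩ := hp
      obtain ⟨t, ht, ht1, ht2⟩ := hq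
      have hd1 : dist p.1 q.1 = lam / (2 * π) * |s - t| := by
        rw [Subtype.dist_eq, Real.dist_eq, hs1, ht1, ← abs_of_nonneg (div_nonneg h0 (by positivity : (0:ℝ) ≤ 2 * π)), ← abs_mul]
        congr 1
        ring
      have hd3 : dist p.1 q.1 ≤ lam := by
        rw [Subtype.dist_eq, Real.dist_eq, abs_le]
        have a := p.1.2
        have b := q.1.2
        constructor <;> linarith [a.1, a.2, b.1, b.2]
      have hd2 : dist p.2 q.2 = ‖((s - t : ℝ) : AddCircle (2 * π))‖ := by
        rw [dist_eq_norm, hs2, ht2, AddCircle.coe_sub]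
      have hn1 : dist p.2 q.2 ≤ |s - t| := by
        rw [hd2]
        exact QuotientAddGroup.norm_mk_le_norm
      have hn2 : dist p.2 q.2 ≤ π := by
        rw [hd2]
        have := AddCircle.norm_le_half_period (2 * π) (x := ((s - t : ℝ) : AddCircle (2 * π))) (by positivity)
        rw [abs_of_pos (by positivity)] at this
        linarith
      have hc0 : 0 ≤ lam / (2 * π) := by positivity
      have hc1 : lam / (2 * π) ≤ 1 := by
        rw [div_le_one (by positivity)]
        linarith
      have hc2 : lam / (2 * π) * π = lam / 2 := by field_simp
      have hdn : 0 ≤ dist p.2 q.2 := dist_nonneg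
      rw [abs_le]
      constructor
      · rw [hd1]
        have e1 := mul_le_mul_of_nonneg_left hn1 hc0
        have e2 := mul_le_mul_of_nonneg_left hn2 (sub_nonneg.2 hc1)
        linarith
      · linarith
    · refine le_iInf₂ fun R hR => ?_
      obtain ⟨y, hy⟩ := hR.1 ⟨lam / 2, by linarith, by linarith⟩
      obtain ⟨⟨x, hx0, hx1⟩, hx⟩ := hR.2 (y + ((2 * π / 2 : ℝ) : AddCircle (2 * π)))
      unfold corDistortion
      refine le_trans ?_ (le_iSup₂_of_le _ hy (le_iSup₂_of_le _ hx le_rfl))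
      apply ENNReal.ofReal_le_ofReal
      have h2 : dist y (y + ((2 * π / 2 : ℝ) : AddCircle (2 * π))) = π := by
        rw [dist_self_add_right, AddCircle.norm_half_period_eq, abs_of_pos (by positivity)]
        ring
      have h1 : |lam / 2 - x| ≤ lam / 2 := by
        rw [abs_le]
        constructor <;> linarith
      simp only [h2, Subtype.dist_eq, Real.dist_eq]
      rw [abs_sub_comm]
      refine le_trans ?_ (le_abs_self _)
      linarith
  unfold ghDist
  rw [key]
  have : π / 2 - lam / 4 = (π - lam / 2) / 2 := by ring
  rw [this, ENNReal.ofReal_div_of_pos (by norm_num)]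
  simp
end

section
/- For 0 < λ ≤ 2π/3, let γ : [0,λ] → S¹ be the map γ(t) = e^{2πit/λ} (identifying ℝ² with ℂ), and let R_λ ⊆ [0,λ] × S¹ be the graph of γ. Then R_λ is a correspondence between I_λ = [0,λ] and S¹ (with its intrinsic metric), and its distortion equals dis R_λ = π − λ/2. -/
open Set Metric Real
open scoped ENNReal

theorem circ_norm_small (x : ℝ) (h0 : 0 ≤ x) (h1 : x ≤ π) :
    ‖((x : ℝ) : AddCircle (2 * π))‖ = x := by
  have hp := Real.pi_pos
  have h := (AddCircle.norm_coe_eq_abs_iff (p := 2 * π) (x := x) (by positivity)).2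
    (by rw [abs_of_nonneg h0, abs_of_pos (by positivity)]; linarith)
  rw [h, abs_of_nonneg h0]

theorem circ_norm_big (x : ℝ) (h0 : π ≤ x) (h1 : x ≤ 2 * π) :
    ‖((x : ℝ) : AddCircle (2 * π))‖ = 2 * π - x := by
  have h := circ_norm_small (2 * π - x) (by linarith) (by linarith)
  rw [AddCircle.coe_sub, AddCircle.coe_period, zero_sub, norm_neg] at h
  exact h

theorem circ_norm_abs (x : ℝ) :
    ‖((x : ℝ) : AddCircle (2 * π))‖ = ‖((|x| : ℝ) : AddCircle (2 * π))‖ := by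
  rcases abs_choice x with h | h <;> rw [h]
  rw [AddCircle.coe_neg, norm_neg]

theorem winding_correspondence_distortion {lam : ℝ} (h0 : 0 < lam)
    (hl : lam ≤ 2 * π / 3) :
    IsCorrespondence ↥(Set.Icc (0:ℝ) lam) (AddCircle (2 * π))
      {p : ↥(Set.Icc (0:ℝ) lam) × AddCircle (2 * π) |
        p.2 = ((2 * π * (p.1 : ℝ) / lam : ℝ) : AddCircle (2 * π))} ∧
    corDistortion ↥(Set.Icc (0:ℝ) lam) (AddCircle (2 * π))
      {p : ↥(Set.Icc (0:ℝ) lam) × AddCircle (2 * π) |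
        p.2 = ((2 * π * (p.1 : ℝ) / lam : ℝ) : AddCircle (2 * π))} = ENNReal.ofReal (π - lam / 2) := by
  have hp := Real.pi_pos
  constructor
  · refine ⟨fun x => ⟨((2 * π * (x : ℝ) / lam : ℝ) : AddCircle (2 * π)), rfl⟩, fun y => ?_⟩
    haveI : Fact (0 < 2 * π) := ⟨by positivity⟩
    have hy := (AddCircle.equivIco (2 * π) 0 y).2
    have hy2 := AddCircle.coe_equivIco (p := 2 * π) (a := 0) (y := y)
    set z : ℝ := (AddCircle.equivIco (2 * π) 0 y : ℝ) with hz
    refine ⟨⟨lam * z / (2 * π), ?_, ?_⟩, ?_⟩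
    · exact div_nonneg (mul_nonneg h0.le hy.1) (by positivity)
    · rw [div_le_iff₀ (by positivity)]
      exact mul_le_mul_of_nonneg_left (by linarith [hy.2]) h0.le
    · change y = ((2 * π * (lam * z / (2 * π)) / lam : ℝ) : AddCircle (2 * π))
      rw [show 2 * π * (lam * z / (2 * π)) / lam = z by field_simp]
      exact hy2.symm
  · apply le_antisymm
    · unfold corDistortion
      refine iSup₂_le fun p hpm => iSup₂_le fun q hq => ENNReal.ofReal_le_ofReal ?_
      obtain ⟨⟨a, ha0, ha1⟩, y⟩ := p
      obtain ⟨⟨b, hb0, hb1⟩, w⟩ := q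
      simp only [Set.mem_setOf_eq] at hpm hq
      subst hpm hq
      rw [Subtype.dist_eq, Real.dist_eq, dist_eq_norm, ← AddCircle.coe_sub, circ_norm_abs]
      simp only
      have e : |2 * π * a / lam - 2 * π * b / lam| = 2 * π * (|a - b| / lam) := by
        rw [show 2 * π * a / lam - 2 * π * b / lam = 2 * π * ((a - b) / lam) by ring,
          abs_mul, abs_div, abs_of_pos h0, abs_of_pos (by positivity : 0 < 2 * π)]
      rw [e]
      have hs0 := abs_nonneg (a - b)
      have hs1 : |a - b| ≤ lam := abs_le.2 ⟨by linarith, by linarith⟩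
      obtain ⟨r, hr⟩ : ∃ r, r = |a - b| / lam := ⟨_, rfl⟩
      have hr' : |a - b| = r * lam := by rw [hr]; field_simp
      rw [← hr, hr']
      have hr0 : 0 ≤ r := by rw [hr]; positivity
      have hr1 : r ≤ 1 := by rw [hr, div_le_one h0]; exact hs1
      rcases le_total r (1 / 2) with h | h
      · rw [circ_norm_small _ (by positivity) (by nlinarith), abs_le]
        constructor <;> nlinarith
      · rw [circ_norm_big _ (by nlinarith) (by nlinarith), abs_le]
        constructor <;> nlinarith
    · unfold corDistortion
      have h1 : (0 : ℝ) ∈ Set.Icc (0 : ℝ) lam := ⟨le_rfl, h0.le⟩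
      have h2 : lam / 2 ∈ Set.Icc (0 : ℝ) lam := ⟨by linarith, by linarith⟩
      refine le_trans ?_ (le_iSup₂_of_le
        (⟨⟨lam / 2, h2⟩, ((2 * π * (lam / 2) / lam : ℝ) : AddCircle (2 * π))⟩) rfl
        (le_iSup₂_of_le (⟨⟨0, h1⟩, ((2 * π * 0 / lam : ℝ) : AddCircle (2 * π))⟩) rfl le_rfl))
      apply ENNReal.ofReal_le_ofReal
      rw [Subtype.dist_eq, Real.dist_eq, dist_eq_norm, ← AddCircle.coe_sub]
      simp only
      rw [show 2 * π * (lam / 2) / lam - 2 * π * 0 / lam = π by field_simp; ring,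
        circ_norm_small _ hp.le le_rfl, sub_zero, abs_of_pos (by linarith : 0 < lam / 2)]
      rw [abs_sub_comm]
      exact le_abs_self _
end

section
/- Let S¹ be the unit circle with intrinsic metric and I_λ = [0,λ] ⊆ ℝ. For every λ with 2π/3 ≤ λ ≤ 7π/6, the Gromov–Hausdorff distance equals d_GH(I_λ, S¹) = π/3. -/
open Set Metric Real
open scoped ENNReal

lemma circ_dist (x y : ℝ) (h : |x - y| ≤ 2 * π) :
    dist (x : AddCircle (2 * π)) (y : AddCircle (2 * π)) = min |x - y| (2 * π - |x - y|) := by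
  have hp := Real.pi_pos
  have hne : (2 * π) ≠ 0 := by positivity
  have habs : |2 * π| = 2 * π := abs_of_pos (by positivity)
  rw [dist_eq_norm, ← AddCircle.coe_sub]
  generalize x - y = u at h ⊢
  by_cases hu : |u| ≤ π
  · rw [(AddCircle.norm_coe_eq_abs_iff (p := 2 * π) hne).2 (by rw [habs]; linarith),
      min_eq_left (by linarith)]
  · push Not at hu
    rw [min_eq_right (by linarith)]
    rcases le_total 0 u with h0 | h0
    · rw [abs_of_nonneg h0] at *
      have e : (u : AddCircle (2 * π)) = ((u - 2 * π : ℝ) : AddCircle (2 * π)) := by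
        rw [AddCircle.coe_sub, AddCircle.coe_period, sub_zero]
      have e2 : |u - 2 * π| = 2 * π - u := by rw [abs_of_nonpos (by linarith)]; ring
      rw [e, (AddCircle.norm_coe_eq_abs_iff (p := 2 * π) hne).2 (by rw [habs, e2]; linarith), e2]
    · rw [abs_of_nonpos h0] at *
      have e : (u : AddCircle (2 * π)) = ((u + 2 * π : ℝ) : AddCircle (2 * π)) := by
        rw [AddCircle.coe_add, AddCircle.coe_period, add_zero]
      have e2 : |u + 2 * π| = 2 * π - -u := by rw [abs_of_nonneg (by linarith)]; ring
      rw [e, (AddCircle.norm_coe_eq_abs_iff (p := 2 * π) hne).2 (by rw [habs, e2]; linarith), e2]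

/-- The relation used for the upper bound, lifted to the plane. -/
def corP (a t x : ℝ) : Prop :=
  (t = a ∧ 0 ≤ x ∧ x ≤ 2 * π / 3) ∨
  (t = a + π / 3 ∧ 2 * π / 3 ≤ x ∧ x ≤ 4 * π / 3) ∨
  (t = a + 2 * π / 3 ∧ -(2 * π / 3) ≤ x ∧ x ≤ 0) ∨
  (0 ≤ t ∧ t ≤ a ∧ x = a - t) ∨
  (a ≤ t ∧ t ≤ a + π / 3 ∧ x = 2 * π / 3) ∨
  (a + π / 3 ≤ t ∧ t ≤ a + 2 * π / 3 ∧ x = 4 * π / 3) ∨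
  (a + 2 * π / 3 ≤ t ∧ t ≤ 2 * a + 2 * π / 3 ∧ x = a + 2 * π / 3 - t)

set_option maxHeartbeats 4000000 in
lemma corP_dist {a : ℝ} (ha : 0 ≤ a) (ha' : a ≤ π / 4) {t x s y : ℝ}
    (h : corP a t x) (h' : corP a s y) (hts : t ≤ s) :
    |x - y| ≤ 2 * π ∧
    |(s - t) - min |x - y| (2 * π - |x - y|)| ≤ 2 * π / 3 := by
  have hp := Real.pi_pos
  suffices H : |x - y| ≤ 2 * π ∧ (min |x - y| (2 * π - |x - y|) ≤ (s - t) + 2 * π / 3) ∧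
      (s - t) - 2 * π / 3 ≤ |x - y| ∧ (s - t) - 2 * π / 3 ≤ 2 * π - |x - y| by
    obtain ⟨h1, h2, h3, h4⟩ := H
    have h5 := le_min h3 h4
    exact ⟨h1, abs_le.2 ⟨by linarith, by linarith⟩⟩
  have key : |x - y| ≤ (s - t) + 2 * π / 3 ∨ 2 * π - |x - y| ≤ (s - t) + 2 * π / 3 →
      min |x - y| (2 * π - |x - y|) ≤ (s - t) + 2 * π / 3 := by
    rintro (h | h)
    · exact (min_le_left _ _).trans h
    · exact (min_le_right _ _).trans h
  suffices H : |x - y| ≤ 2 * π ∧ (|x - y| ≤ (s - t) + 2 * π / 3 ∨ 2 * π - |x - y| ≤ (s - t) + 2 * π / 3) ∧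
      (s - t) - 2 * π / 3 ≤ |x - y| ∧ (s - t) - 2 * π / 3 ≤ 2 * π - |x - y| from
    ⟨H.1, key H.2.1, H.2.2⟩
  clear key
  have hor : |x - y| ≤ (s - t) + 2 * π / 3 ∨ (s - t) + 2 * π / 3 < |x - y| := le_or_gt _ _
  unfold corP at h h'
  rcases h with ⟨h1, h2, h3⟩ | ⟨h1, h2, h3⟩ | ⟨h1, h2, h3⟩ | ⟨h1, h2, h3⟩ | ⟨h1, h2, h3⟩ | ⟨h1, h2, h3⟩ | ⟨h1, h2, h3⟩ <;>
  rcases h' with ⟨g1, g2, g3⟩ | ⟨g1, g2, g3⟩ | ⟨g1, g2, g3⟩ | ⟨g1, g2, g3⟩ | ⟨g1, g2, g3⟩ | ⟨g1, g2, g3⟩ | ⟨g1, g2, g3⟩ <;>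
  rcases abs_cases (x - y) with ⟨e, e'⟩ | ⟨e, e'⟩ <;> rw [e] at hor ⊢ <;>
  refine ⟨by linarith, ?_, by linarith, by linarith⟩ <;>
  first
  | exact Or.inl (by linarith)
  | exact Or.inr (by linarith)
  | (rcases hor with q | q
     · exact Or.inl q
     · exact Or.inr (by linarith))

lemma upper_bound {lam : ℝ} (h1 : 2 * π / 3 ≤ lam) (h2 : lam ≤ 7 * π / 6) :
    ∃ R : Set (↥(Set.Icc (0:ℝ) lam) × AddCircle (2 * π)),
      IsCorrespondence _ _ R ∧ corDistortion _ _ R ≤ ENNReal.ofReal (2 * π / 3) := by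
  have hp := Real.pi_pos
  obtain ⟨a, rfl⟩ : ∃ a, lam = 2 * a + 2 * π / 3 := ⟨(lam - 2 * π / 3) / 2, by ring⟩
  have ha : 0 ≤ a := by linarith
  have ha' : a ≤ π / 4 := by linarith
  refine ⟨{p | ∃ x : ℝ, corP a p.1 x ∧ p.2 = (x : AddCircle (2 * π))}, ⟨?_, ?_⟩, ?_⟩
  · rintro ⟨t, ht0, ht1⟩
    suffices H : ∃ x, corP a t x by
      obtain ⟨x, hx⟩ := H
      exact ⟨x, x, hx, rfl⟩
    unfold corP
    rcases le_total t a with q | q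
    · exact ⟨_, Or.inr <| Or.inr <| Or.inr <| Or.inl ⟨ht0, q, rfl⟩⟩
    rcases le_total t (a + π / 3) with q2 | q2
    · exact ⟨_, Or.inr <| Or.inr <| Or.inr <| Or.inr <| Or.inl ⟨q, q2, rfl⟩⟩
    rcases le_total t (a + 2 * π / 3) with q3 | q3
    · exact ⟨_, Or.inr <| Or.inr <| Or.inr <| Or.inr <| Or.inr <| Or.inl ⟨q2, q3, rfl⟩⟩
    · exact ⟨_, Or.inr <| Or.inr <| Or.inr <| Or.inr <| Or.inr <| Or.inr ⟨q3, ht1, rfl⟩⟩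
  · intro y
    haveI : Fact (0 < 2 * π) := ⟨by positivity⟩
    obtain ⟨x, hx, rfl⟩ : ∃ x ∈ Set.Ico (-(2 * π / 3)) (-(2 * π / 3) + 2 * π), (x : AddCircle (2 * π)) = y := by
      have := AddCircle.coe_image_Ico_eq (2 * π) (-(2 * π / 3))
      have hy : y ∈ (Set.univ : Set (AddCircle (2 * π))) := trivial
      rw [← this] at hy
      exact hy
    obtain ⟨hx1, hx2⟩ := hx
    suffices H : ∃ t, (0 ≤ t ∧ t ≤ 2 * a + 2 * π / 3) ∧ corP a t x by
      obtain ⟨t, ht, hx⟩ := H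
      exact ⟨⟨t, ht⟩, x, hx, rfl⟩
    unfold corP
    rcases le_total x 0 with q | q
    · exact ⟨_, ⟨by positivity, by linarith⟩, Or.inr <| Or.inr <| Or.inl ⟨rfl, hx1, q⟩⟩
    rcases le_total x (2 * π / 3) with q2 | q2
    · exact ⟨_, ⟨by positivity, by linarith⟩, Or.inl ⟨rfl, q, q2⟩⟩
    · exact ⟨_, ⟨by positivity, by linarith⟩, Or.inr <| Or.inl ⟨rfl, q2, by linarith⟩⟩
  · unfold corDistortion
    refine iSup₂_le fun p hpR => iSup₂_le fun q hqR => ENNReal.ofReal_le_ofReal ?_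
    obtain ⟨⟨t, ht⟩, y1⟩ := p
    obtain ⟨⟨s, hs⟩, y2⟩ := q
    obtain ⟨x, hx, hxe⟩ := hpR
    obtain ⟨z, hz, hze⟩ := hqR
    dsimp only at *
    subst hxe hze
    rw [Subtype.dist_eq, Real.dist_eq]
    dsimp only
    rcases le_total t s with q | q
    · obtain ⟨k1, k2⟩ := corP_dist ha ha' hx hz q
      rw [circ_dist _ _ k1, abs_sub_comm t s, abs_of_nonneg (sub_nonneg.2 q)]
      exact k2
    · obtain ⟨k1, k2⟩ := corP_dist ha ha' hz hx q
      rw [dist_comm, circ_dist _ _ k1, abs_of_nonneg (sub_nonneg.2 q)]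
      exact k2

lemma no_fun (f : AddCircle (2 * π) → ℝ) (d : ℝ) (hd : d < 2 * π / 3)
    (h : ∀ y z, |(|f y - f z|) - dist y z| ≤ d) : False := by
  have hp := Real.pi_pos
  have hD : ∀ x y : ℝ, |x - y| ≤ 2 * π →
      min |x - y| (2 * π - |x - y|) - d ≤ |f x - f y| ∧
      |f x - f y| ≤ min |x - y| (2 * π - |x - y|) + d := by
    intro x y hxy
    have := h x y
    rw [circ_dist x y hxy, abs_le] at this
    constructor <;> linarith [this.1, this.2]
  -- choose a small step
  obtain ⟨N, hN⟩ := exists_nat_gt (π / min ((2 * π / 3 - d) / 2) π)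
  set e0 := min ((2 * π / 3 - d) / 2) π with he0
  have he0p : 0 < e0 := lt_min (by linarith) hp
  have hNp : (0:ℝ) < N := lt_trans (by positivity) hN
  set e := π / N with he
  have hep : 0 < e := by positivity
  have hee : e < e0 := by
    rw [he, div_lt_iff₀ hNp]; rw [div_lt_iff₀ he0p] at hN; linarith
  have hed : e < (2 * π / 3 - d) / 2 := lt_of_lt_of_le hee (min_le_left _ _)
  have hepi : e < π := lt_of_lt_of_le hee (min_le_right _ _)
  have near : ∀ x : ℝ, |f (x : ℝ) - f ((x + e : ℝ))| ≤ e + d := by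
    intro x
    have e1 : |x - (x + e)| = e := by rw [show x - (x + e) = -e by ring, abs_neg, abs_of_pos hep]
    have := (hD x (x + e) (by rw [e1]; linarith)).2
    rw [e1] at this
    exact this.trans (by gcongr; exact min_le_left _ _)
  have far : ∀ x c : ℝ, π - e ≤ c → c ≤ π + e → π - e - d ≤ |f (x : ℝ) - f ((x + c : ℝ))| := by
    intro x c hc hc'
    have e1 : |x - (x + c)| = c := by
      rw [show x - (x + c) = -c by ring, abs_neg, abs_of_pos (by linarith)]
    have := (hD x (x + c) (by rw [e1]; linarith)).1
    rw [e1] at this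
    have k : π - e ≤ min c (2 * π - c) := le_min hc (by linarith)
    linarith
  have step : ∀ x : ℝ, f ((x + π : ℝ)) < f (x : ℝ) → f ((x + e + π : ℝ)) < f ((x + e : ℝ)) := by
    intro x hx
    by_contra hc
    push Not at hc
    have a1 := near x
    have a2 := near (x + π)
    have b1 := far x π (by linarith) (by linarith)
    have b2 := far (x + e) π (by linarith) (by linarith)
    have b3 := far x (π + e) (by linarith) (by linarith)
    have b4 := far (x + e) (π - e) (by linarith) (by linarith)
    rw [show x + π + e = x + e + π by ring] at a2
    rw [show x + (π + e) = x + e + π by ring] at b3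
    rw [show x + e + (π - e) = x + π by ring] at b4
    generalize f (x : ℝ) = u at *
    generalize f ((x + e : ℝ)) = u' at *
    generalize f ((x + π : ℝ)) = v at *
    generalize f ((x + e + π : ℝ)) = v' at *
    clear hD near far h
    rw [abs_le] at a1 a2
    rw [le_abs] at b1 b2 b3 b4
    obtain ⟨a1, a1'⟩ := a1
    obtain ⟨a2, a2'⟩ := a2
    rcases b1 with b1 | b1 <;> rcases b2 with b2 | b2 <;> rcases b3 with b3 | b3 <;>
      rcases b4 with b4 | b4 <;> linarith
  have iter : ∀ x : ℝ, f ((x + π : ℝ)) < f (x : ℝ) →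
      ∀ n : ℕ, f ((x + n * e + π : ℝ)) < f ((x + n * e : ℝ)) := by
    intro x hx n
    induction n with
    | zero => simpa using hx
    | succ n ih =>
      have := step _ ih
      push_cast
      rw [show x + (n + 1) * e = x + n * e + e by ring]
      exact this
  have hNe : (N : ℝ) * e = π := by rw [he]; field_simp
  have main : ∀ x : ℝ, ¬ f ((x + π : ℝ)) < f (x : ℝ) := by
    intro x hx
    have := iter x hx N
    rw [hNe] at this
    have e1 : ((x + π + π : ℝ) : AddCircle (2 * π)) = (x : ℝ) := by
      rw [show x + π + π = x + 2 * π by ring, AddCircle.coe_add, AddCircle.coe_period, add_zero]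
    rw [e1] at this
    linarith
  have m0 := main 0
  have m1 := main (0 + π)
  have e1 : ((0 + π + π : ℝ) : AddCircle (2 * π)) = (0 : ℝ) := by
    rw [show (0:ℝ) + π + π = 0 + 2 * π by ring, AddCircle.coe_add, AddCircle.coe_period, add_zero]
  rw [e1] at m1
  have b1 := far 0 π (by linarith) (by linarith)
  have : f ((0:ℝ)) = f ((0 + π : ℝ)) := le_antisymm (not_lt.1 m0) (not_lt.1 m1)
  rw [this, sub_self, abs_zero] at b1
  linarith

lemma lower_bound {lam : ℝ} (R : Set (↥(Set.Icc (0:ℝ) lam) × AddCircle (2 * π)))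
    (hR : IsCorrespondence _ _ R) : ENNReal.ofReal (2 * π / 3) ≤ corDistortion _ _ R := by
  by_contra hc
  push Not at hc
  have hp := Real.pi_pos
  have hfin : corDistortion _ _ R ≠ ⊤ := ne_top_of_lt hc
  choose f hf using hR.2
  refine no_fun (fun y => (f y : ℝ)) (corDistortion _ _ R).toReal ?_ ?_
  · exact (ENNReal.lt_ofReal_iff_toReal_lt hfin).1 hc
  · intro y z
    have : ENNReal.ofReal |dist (f y) (f z) - dist y z| ≤ corDistortion _ _ R := by
      unfold corDistortion
      exact le_iSup₂_of_le (f y, y) (hf y) (le_iSup₂_of_le (f z, z) (hf z) le_rfl)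
    rw [ENNReal.ofReal_le_iff_le_toReal hfin] at this
    rwa [Subtype.dist_eq, Real.dist_eq] at this

theorem ghDist_segment_circle_middle {lam : ℝ} (h1 : 2 * π / 3 ≤ lam)
    (h2 : lam ≤ 7 * π / 6) :
    ghDist ↥(Set.Icc (0:ℝ) lam) (AddCircle (2 * π)) = ENNReal.ofReal (π / 3) := by
  have key : (⨅ R ∈ {R : Set (↥(Set.Icc (0:ℝ) lam) × AddCircle (2 * π)) |
      IsCorrespondence _ _ R}, corDistortion _ _ R) = ENNReal.ofReal (2 * π / 3) := by
    apply le_antisymm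
    · obtain ⟨R, hR, hd⟩ := upper_bound h1 h2
      exact (iInf₂_le R hR).trans hd
    · exact le_iInf₂ fun R hR => lower_bound R hR
  unfold ghDist
  rw [key, show (2:ℝ≥0∞) = ENNReal.ofReal 2 by simp, ← ENNReal.ofReal_div_of_pos (by norm_num)]
  congr 1
  ring
end

section
/- Let S¹ be the unit circle with intrinsic metric and I_λ = [0,λ] ⊆ ℝ. For every λ with π ≤ λ ≤ 5π/3, the Gromov–Hausdorff distance satisfies d_GH(I_λ, S¹) ≥ π/3. -/
open Set Metric Real
open scoped ENNReal

theorem circle_real_aux (f : AddCircle (2 * π) → ℝ) (d : ℝ) (hd : d < 2 * π / 3)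
    (hf : ∀ a b, |dist (f a) (f b) - dist a b| ≤ d) : False := by
  have hpi := Real.pi_pos
  have hhalf : ∀ a : AddCircle (2 * π), dist a (a + ((π : ℝ) : AddCircle (2 * π))) = π := by
    intro a
    rw [dist_eq_norm, sub_add_cancel_left, norm_neg]
    have := AddCircle.norm_half_period_eq (2 * π)
    rw [mul_div_cancel_left₀ _ (two_ne_zero)] at this
    rw [this, abs_of_pos (by positivity)]
    ring
  have hsmall : ∀ x y : ℝ, dist (x : AddCircle (2 * π)) (y : AddCircle (2 * π)) ≤ |x - y| := by
    intro x y
    rw [dist_eq_norm, ← AddCircle.coe_sub]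
    exact QuotientAddGroup.norm_mk_le_norm
  set q : AddCircle (2 * π) := ((π : ℝ) : AddCircle (2 * π)) with hq
  have hqq : q + q = 0 := by
    rw [hq, ← AddCircle.coe_add, ← two_mul]
    exact AddCircle.coe_period _
  let P : Set ℝ := {t | f ((t : AddCircle (2 * π)) + q) < f (t : AddCircle (2 * π))}
  have key : ∀ x y : ℝ, |x - y| < (2 * π - 3 * d) / 3 → x ∈ P → y ∈ P := by
    intro x y hxy hx
    by_contra hy
    have hx' : f ((x : AddCircle (2 * π)) + q) < f (x : AddCircle (2 * π)) := hx
    have hy' : f (y : AddCircle (2 * π)) ≤ f ((y : AddCircle (2 * π)) + q) := not_lt.mp hy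
    have hs := hsmall x y
    generalize (x : AddCircle (2 * π)) = a at *
    generalize (y : AddCircle (2 * π)) = b at *
    have e1 := hf a (a + q)
    have e2 := hf b (b + q)
    have e3 := hf a (b + q)
    have e4 := hf a b
    have e5 := hf (a + q) (b + q)
    rw [hhalf] at e1 e2
    rw [dist_add_right] at e5
    have t1 := dist_triangle_right b (b + q) a
    rw [hhalf, dist_comm b a, dist_comm (b + q) a] at t1
    simp only [Real.dist_eq] at e1 e2 e3 e4 e5
    rw [abs_le] at e1 e2 e3 e4 e5
    rw [abs_of_pos (by linarith)] at e1
    rw [abs_of_nonpos (by linarith)] at e2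
    have u4 := le_abs_self (f a - f b)
    have u5 := neg_le_abs (f (a + q) - f (b + q))
    rcases abs_cases (f a - f (b + q)) with h | h <;> linarith
  have hε : 0 < (2 * π - 3 * d) / 3 := by linarith
  have hclopen : IsClopen P := by
    constructor
    · rw [← isOpen_compl_iff, Metric.isOpen_iff]
      intro x hx
      refine ⟨_, hε, fun y hy hyP => hx (key y x ?_ hyP)⟩
      simpa [Real.dist_eq] using hy
    · rw [Metric.isOpen_iff]
      intro x hx
      refine ⟨_, hε, fun y hy => key x y ?_ hx⟩
      rw [mem_ball, dist_comm] at hy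
      simpa [Real.dist_eq] using hy
  have hne : f q ≠ f 0 := by
    intro h
    have e := hf 0 (0 + q)
    rw [hhalf, zero_add, h, dist_self, abs_le] at e
    linarith
  have h0 : (0 : ℝ) ∈ P ↔ f q < f 0 := by simp [P]
  have h1 : π ∈ P ↔ f 0 < f q := by
    change f (q + q) < f q ↔ _
    rw [hqq]
  rcases isClopen_iff.mp hclopen with h | h <;> rw [h] at h0 h1 <;> simp at h0 h1
  · exact hne (le_antisymm h1 h0)
  · exact lt_asymm h0 h1

theorem ghDist_segment_circle_ge_pi_div_three {lam : ℝ} (h1 : π ≤ lam)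
    (h2 : lam ≤ 5 * π / 3) :
    ENNReal.ofReal (π / 3) ≤ ghDist ↥(Set.Icc (0:ℝ) lam) (AddCircle (2 * π)) := by
  unfold ghDist
  rw [ENNReal.le_div_iff_mul_le (by simp) (by simp)]
  refine le_iInf₂ fun R hR => ?_
  by_contra hlt
  rw [not_le] at hlt
  have hR' : IsCorrespondence _ _ R := hR
  choose f hf using hR'.2
  have hpi := Real.pi_pos
  have heq : ENNReal.ofReal (π / 3) * 2 = ENNReal.ofReal (2 * π / 3) := by
    rw [← ENNReal.ofReal_ofNat 2, ← ENNReal.ofReal_mul (by positivity)]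
    congr 1
    ring
  rw [heq] at hlt
  have hfin : corDistortion _ _ R ≠ ⊤ := hlt.ne_top
  refine circle_real_aux (fun a => (f a : ℝ)) (corDistortion _ _ R).toReal ?_ ?_
  · rwa [← ENNReal.lt_ofReal_iff_toReal_lt hfin]
  · intro a b
    rw [← ENNReal.ofReal_le_iff_le_toReal hfin]
    unfold corDistortion
    exact le_iSup₂_of_le (f a, a) (hf a) (le_iSup₂_of_le (f b, b) (hf b) le_rfl)
end

section
/- Let S¹ be the unit circle with intrinsic metric and I_λ = [0,λ] ⊆ ℝ. For every λ with π ≤ λ ≤ 5π/3, the Gromov–Hausdorff distance equals d_GH(I_λ, S¹) = π/3. -/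
open Set Metric Real
open scoped ENNReal

theorem acDist_eq (x y : ℝ) (h0 : x ≤ y) (h1 : y ≤ x + 2 * π) :
    dist (x : AddCircle (2 * π)) (y : AddCircle (2 * π)) = min (y - x) (2 * π - (y - x)) := by
  have hp : (0:ℝ) < π := Real.pi_pos
  have hn : (2 * π : ℝ) ≠ 0 := by positivity
  rw [dist_comm, dist_eq_norm, ← AddCircle.coe_sub]
  rcases le_total (y - x) π with h | h
  · rw [(AddCircle.norm_coe_eq_abs_iff (2 * π) hn).2
      (by rw [abs_of_nonneg (by linarith), abs_of_pos (by linarith)]; linarith)]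
    rw [abs_of_nonneg (by linarith), min_eq_left (by linarith)]
  · have e : ((y - x : ℝ) : AddCircle (2 * π)) = ((y - x - 2 * π : ℝ) : AddCircle (2 * π)) := by
      rw [AddCircle.coe_sub (x := y - x), AddCircle.coe_period, sub_zero]
    rw [e, (AddCircle.norm_coe_eq_abs_iff (2 * π) hn).2
      (by rw [abs_of_nonpos (by linarith), abs_of_pos (by linarith)]; linarith)]
    rw [abs_of_nonpos (by linarith), min_eq_right (by linarith)]
    ring

theorem four_reals {p p' q q' g : ℝ} (h1 : p < q) (a1 : g < |p - q|) (a2 : g < |p - q'|)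
    (a3 : g < |p' - q|) (a4 : g < |p' - q'|) (b1 : |p - p'| < 2 * g) (b2 : |q - q'| < 2 * g) :
    p' < q' := by
  by_contra hc
  push Not at hc
  rw [abs_lt] at b1 b2
  rw [lt_abs] at a1 a3 a4
  rcases a1 with a1 | a1 <;> rcases a3 with a3 | a3 <;> rcases a4 with a4 | a4 <;> linarith

theorem no_map (F : ℝ → ℝ) (δ : ℝ) (hδ : δ < 2 * π / 3)
    (hF : ∀ x y : ℝ, |dist (F x) (F y) - dist (x : AddCircle (2 * π)) (y : AddCircle (2 * π))| ≤ δ)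
    (hper : ∀ x, F (x + 2 * π) = F x) : False := by
  have hp : (0:ℝ) < π := Real.pi_pos
  obtain ⟨N, hN⟩ := exists_nat_gt (π / (2 * π / 3 - δ))
  have hpos : 0 < 2 * π / 3 - δ := by linarith
  have hN0 : (0:ℝ) < N := lt_trans (by positivity) hN
  have hN1 : (1:ℝ) ≤ N := by
    have : 0 < N := by exact_mod_cast hN0
    exact_mod_cast this
  obtain ⟨η, hη⟩ : ∃ η, η = π / N := ⟨_, rfl⟩
  have hη0 : 0 < η := by rw [hη]; positivity
  have hη1 : η ≤ π := by rw [hη]; exact div_le_self hp.le hN1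
  have hη2 : η < 2 * π / 3 - δ := by
    rw [hη]
    rw [div_lt_iff₀ hpos] at hN
    rw [div_lt_iff₀ hN0]; linarith
  have hNη : N * η = π := by rw [hη]; field_simp
  have far : ∀ x y : ℝ, x + π - η ≤ y → y ≤ x + π + η → π / 3 < |F x - F y| := by
    intro x y h1 h2
    have h := hF x y
    rw [acDist_eq x y (by linarith) (by linarith), Real.dist_eq, abs_le] at h
    have : π - η ≤ min (y - x) (2 * π - (y - x)) := le_min (by linarith) (by linarith)
    linarith
  have near : ∀ x : ℝ, |F x - F (x + η)| < 2 * (π / 3) := by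
    intro x
    have h := hF x (x + η)
    rw [acDist_eq x _ (by linarith) (by linarith), Real.dist_eq, abs_le] at h
    have : min (x + η - x) (2 * π - (x + η - x)) ≤ x + η - x := min_le_left _ _
    linarith
  have step : ∀ x, F x < F (x + π) → F (x + η) < F (x + η + π) := by
    intro x h
    refine four_reals (g := π / 3) h (far _ _ ?_ ?_) (far _ _ ?_ ?_) ?_ (far _ _ ?_ ?_) (near x) ?_
    · linarith
    · linarith
    · linarith
    · linarith
    · exact far _ _ (by linarith) (by linarith)
    · linarith
    · linarith
    · have := near (x + π)
      rwa [add_right_comm] at this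
  have steps : ∀ (n : ℕ) x, F x < F (x + π) → F (x + n * η) < F (x + n * η + π) := by
    intro n x h
    induction n with
    | zero => simpa using h
    | succ k ih =>
      have := step _ ih
      have e : x + k * η + η = x + ((k + 1 : ℕ) : ℝ) * η := by push_cast; ring
      rwa [e] at this
  have key : ∀ x, F x < F (x + π) → F (x + π) < F x := by
    intro x h
    have := steps N x h
    rw [hNη] at this
    have e : x + π + π = x + 2 * π := by ring
    rwa [e, hper] at this
  rcases lt_trichotomy (F 0) (F (0 + π)) with h | h | h
  · exact lt_asymm h (key _ h)
  · have := far 0 (0 + π) (by linarith) (by linarith)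
    rw [h, sub_self, abs_zero] at this
    linarith
  · have e : F (0 + π + π) = F 0 := by
      rw [← hper 0]; congr 1; ring
    have := key (0 + π) (by rw [e]; exact h)
    rw [e] at this
    exact lt_asymm h this

/-- dip function -/
noncomputable def dipM (a c x : ℝ) : ℝ := min x (min (3 * c - x) a)

/-- the parametrized correspondence -/
noncomputable def mapF (a c x : ℝ) : ℝ :=
  if x ≤ 2 * c then a - dipM a c x
  else if x ≤ 4 * c then a + x - 2 * c
  else a + 2 * c + dipM a c (6 * c - x)

theorem dipM_spec (a c x : ℝ) (ha : c / 2 ≤ a) (ha' : a ≤ 3 * c / 2) (hc : 0 < c)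
    (h0 : 0 ≤ x) (h1 : x ≤ 2 * c) :
    0 ≤ dipM a c x ∧ dipM a c x ≤ x ∧ dipM a c x ≤ 3 * c - x ∧ dipM a c x ≤ a := by
  unfold dipM
  refine ⟨le_min h0 (le_min (by linarith) (by linarith)), min_le_left _ _,
    (min_le_right _ _).trans (min_le_left _ _), (min_le_right _ _).trans (min_le_right _ _)⟩

theorem mapF_dist (a c x y : ℝ) (ha : c / 2 ≤ a) (ha' : a ≤ 3 * c / 2) (hc : 0 < c)
    (h0 : 0 ≤ x) (hxy : x ≤ y) (h1 : y ≤ 6 * c) :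
    |(|mapF a c x - mapF a c y|) - min (y - x) (6 * c - (y - x))| ≤ 2 * c := by
  have l1 : min (y - x) (6 * c - (y - x)) ≤ y - x := min_le_left _ _
  have l2 : min (y - x) (6 * c - (y - x)) ≤ 6 * c - (y - x) := min_le_right _ _
  have l3 : min (y - x) (6 * c - (y - x)) = y - x ∨
    min (y - x) (6 * c - (y - x)) = 6 * c - (y - x) := min_choice _ _
  have l4 : 0 ≤ min (y - x) (6 * c - (y - x)) := le_min (by linarith) (by linarith)
  generalize min (y - x) (6 * c - (y - x)) = d at *
  unfold mapF
  have px := dipM_spec a c x ha ha' hc h0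
  have py := dipM_spec a c y ha ha' hc (by linarith)
  have nx := fun h => dipM_spec a c (6 * c - x) ha ha' hc (by linarith) h
  have ny := fun h => dipM_spec a c (6 * c - y) ha ha' hc (by linarith) h
  generalize dipM a c x = mx at *
  generalize dipM a c y = my at *
  generalize dipM a c (6 * c - x) = kx at *
  generalize dipM a c (6 * c - y) = ky at *
  rcases le_or_gt x (2 * c) with hx | hx
  · obtain ⟨p1, p2, p3, p4⟩ := px hx
    rw [if_pos hx]
    rcases le_or_gt y (2 * c) with hy | hy
    · obtain ⟨q1, q2, q3, q4⟩ := py hy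
      rw [if_pos hy, abs_le]
      rcases abs_cases (a - mx - (a - my)) with ⟨e, _⟩ | ⟨e, _⟩ <;> rw [e] <;>
        rcases l3 with l3 | l3 <;> constructor <;> linarith
    rw [if_neg (not_le.2 hy)]
    rcases le_or_gt y (4 * c) with hy' | hy'
    · rw [if_pos hy', abs_le, abs_of_nonpos (by linarith)]
      rcases l3 with l3 | l3 <;> constructor <;> linarith
    · obtain ⟨q1, q2, q3, q4⟩ := ny (by linarith)
      rw [if_neg (not_le.2 hy'), abs_le, abs_of_nonpos (by linarith)]
      rcases l3 with l3 | l3 <;> constructor <;> linarith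
  rw [if_neg (not_le.2 hx), if_neg (by linarith : ¬ y ≤ 2 * c)]
  rcases le_or_gt x (4 * c) with hx' | hx'
  · rw [if_pos hx']
    rcases le_or_gt y (4 * c) with hy' | hy'
    · rw [if_pos hy', abs_le, abs_of_nonpos (by linarith)]
      rcases l3 with l3 | l3 <;> constructor <;> linarith
    · obtain ⟨q1, q2, q3, q4⟩ := ny (by linarith)
      rw [if_neg (not_le.2 hy'), abs_le, abs_of_nonpos (by linarith)]
      rcases l3 with l3 | l3 <;> constructor <;> linarith
  · obtain ⟨p1, p2, p3, p4⟩ := nx (by linarith)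
    obtain ⟨q1, q2, q3, q4⟩ := ny (by linarith)
    rw [if_neg (not_le.2 hx'), if_neg (by linarith : ¬ y ≤ 4 * c), abs_le]
    rcases abs_cases (a + 2 * c + kx - (a + 2 * c + ky)) with ⟨e, _⟩ | ⟨e, _⟩ <;> rw [e] <;>
      rcases l3 with l3 | l3 <;> constructor <;> linarith

theorem lower {lam : ℝ} (R : Set (↥(Set.Icc (0:ℝ) lam) × AddCircle (2 * π)))
    (hR : IsCorrespondence ↥(Set.Icc (0:ℝ) lam) (AddCircle (2 * π)) R) :
    ENNReal.ofReal (2 * π / 3) ≤ corDistortion ↥(Set.Icc (0:ℝ) lam) (AddCircle (2 * π)) R := by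
  by_contra hc
  push Not at hc
  choose f hf using hR.2
  have hD : corDistortion ↥(Set.Icc (0:ℝ) lam) (AddCircle (2 * π)) R ≠ ⊤ := ne_top_of_lt hc
  refine no_map (fun x => (f (x : AddCircle (2 * π)) : ℝ))
    (corDistortion ↥(Set.Icc (0:ℝ) lam) (AddCircle (2 * π)) R).toReal ?_ ?_ ?_
  · rw [ENNReal.lt_ofReal_iff_toReal_lt hD] at hc
    exact hc
  · intro x y
    rw [← ENNReal.ofReal_le_iff_le_toReal hD]
    exact le_iSup₂_of_le (f := fun p (_ : p ∈ R) => ⨆ q ∈ R,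
        ENNReal.ofReal |dist p.1 q.1 - dist p.2 q.2|) _ (hf (x : AddCircle (2 * π)))
      (le_iSup₂_of_le (f := fun q (_ : q ∈ R) =>
        ENNReal.ofReal |dist (f (x : AddCircle (2 * π))) q.1 - dist (x : AddCircle (2 * π)) q.2|)
        _ (hf (y : AddCircle (2 * π))) le_rfl)
  · intro x
    simp only [AddCircle.coe_add, AddCircle.coe_period, add_zero]

theorem mapF_mem (a c x : ℝ) (ha : c / 2 ≤ a) (ha' : a ≤ 3 * c / 2) (hc : 0 < c)
    (h0 : 0 ≤ x) (h1 : x ≤ 6 * c) : 0 ≤ mapF a c x ∧ mapF a c x ≤ 2 * a + 2 * c := by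
  unfold mapF
  split_ifs with h h'
  · obtain ⟨p1, p2, p3, p4⟩ := dipM_spec a c x ha ha' hc h0 h
    constructor <;> linarith
  · constructor <;> linarith
  · obtain ⟨p1, p2, p3, p4⟩ := dipM_spec a c (6 * c - x) ha ha' hc (by linarith) (by linarith)
    constructor <;> linarith

theorem mapF_surj (a c t : ℝ) (ha : c / 2 ≤ a) (ha' : a ≤ 3 * c / 2) (hc : 0 < c)
    (h0 : 0 ≤ t) (h1 : t ≤ 2 * a + 2 * c) : ∃ x, 0 ≤ x ∧ x ≤ 6 * c ∧ mapF a c x = t := by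
  have hd : ∀ s, 0 ≤ s → s ≤ a → dipM a c s = s := fun s h h' =>
    min_eq_left (le_min (by linarith) h')
  rcases le_total t a with h | h
  · refine ⟨a - t, by linarith, by linarith, ?_⟩
    unfold mapF
    rw [if_pos (by linarith), hd _ (by linarith) (by linarith)]
    ring
  rcases le_or_gt t (a + 2 * c) with h' | h'
  · rcases h.eq_or_lt with h | h
    · refine ⟨0, by linarith, by linarith, ?_⟩
      unfold mapF
      rw [if_pos (by linarith), hd _ (by linarith) (by linarith), h]
      ring
    · refine ⟨t - a + 2 * c, by linarith, by linarith, ?_⟩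
      unfold mapF
      rw [if_neg (by linarith), if_pos (by linarith)]
      ring
  · refine ⟨6 * c - (t - a - 2 * c), by linarith, by linarith, ?_⟩
    unfold mapF
    rw [if_neg (by linarith), if_neg (by linarith), sub_sub_cancel, hd _ (by linarith) (by linarith)]
    ring

theorem upper {lam : ℝ} (h1 : π ≤ lam) (h2 : lam ≤ 5 * π / 3) :
    (⨅ R ∈ {R : Set (↥(Set.Icc (0:ℝ) lam) × AddCircle (2 * π)) |
      IsCorrespondence ↥(Set.Icc (0:ℝ) lam) (AddCircle (2 * π)) R},
      corDistortion ↥(Set.Icc (0:ℝ) lam) (AddCircle (2 * π)) R) ≤ ENNReal.ofReal (2 * π / 3) := by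
  have hp : (0:ℝ) < π := Real.pi_pos
  have : Fact (0 < 2 * π) := ⟨by positivity⟩
  obtain ⟨c, hc⟩ : ∃ c, c = π / 3 := ⟨_, rfl⟩
  obtain ⟨a, ha⟩ : ∃ a, a = lam / 2 - c := ⟨_, rfl⟩
  have hc0 : 0 < c := by rw [hc]; positivity
  have ha1 : c / 2 ≤ a := by linarith
  have ha2 : a ≤ 3 * c / 2 := by linarith
  refine iInf₂_le_of_le {q | ∃ x : ℝ, 0 ≤ x ∧ x ≤ 6 * c ∧ mapF a c x = q.1 ∧
    (x : AddCircle (2 * π)) = q.2} ⟨?_, ?_⟩ ?_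
  · rintro ⟨t, ht0, ht1⟩
    obtain ⟨x, hx0, hx1, hx⟩ := mapF_surj a c t ha1 ha2 hc0 ht0 (by linarith)
    exact ⟨x, x, hx0, hx1, hx, rfl⟩
  · intro y
    obtain ⟨x, hx, rfl⟩ : y ∈ (fun x : ℝ => (x : AddCircle (2 * π))) '' Set.Ico 0 (0 + 2 * π) := by
      have := AddCircle.coe_image_Ico_eq (2 * π) 0
      rw [this]; trivial
    have hx1 : x ≤ 6 * c := by linarith [hx.2]
    have hm := mapF_mem a c x ha1 ha2 hc0 hx.1 hx1
    exact ⟨⟨mapF a c x, hm.1, by linarith [hm.2]⟩, x, hx.1, hx1, rfl, rfl⟩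
  · have main : ∀ x y : ℝ, 0 ≤ x → x ≤ y → y ≤ 6 * c →
        |dist (mapF a c x) (mapF a c y) -
          dist (x : AddCircle (2 * π)) (y : AddCircle (2 * π))| ≤ 2 * π / 3 := by
      intro x y h0 hxy hy
      have := mapF_dist a c x y ha1 ha2 hc0 h0 hxy hy
      rw [acDist_eq x y hxy (by linarith), Real.dist_eq]
      rw [show 6 * c = 2 * π by linarith] at this
      linarith
    refine iSup₂_le fun p hp' => iSup₂_le fun q hq => ENNReal.ofReal_le_ofReal ?_
    obtain ⟨x, hx0, hx1, hx, hxp⟩ := hp'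
    obtain ⟨y, hy0, hy1, hy, hyq⟩ := hq
    rw [Subtype.dist_eq, ← hx, ← hy, ← hxp, ← hyq]
    rcases le_total x y with h | h
    · exact main x y hx0 h hy1
    · rw [dist_comm (mapF a c x), dist_comm (x : AddCircle (2 * π))]
      exact main y x hy0 h hx1

theorem ghDist_segment_circle_middle' {lam : ℝ} (h1 : π ≤ lam)
    (h2 : lam ≤ 5 * π / 3) :
    ghDist ↥(Set.Icc (0:ℝ) lam) (AddCircle (2 * π)) = ENNReal.ofReal (π / 3) := by
  have hp : (0:ℝ) < π := Real.pi_pos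
  unfold ghDist
  have hinf : (⨅ R ∈ {R : Set (↥(Set.Icc (0:ℝ) lam) × AddCircle (2 * π)) |
      IsCorrespondence ↥(Set.Icc (0:ℝ) lam) (AddCircle (2 * π)) R},
      corDistortion ↥(Set.Icc (0:ℝ) lam) (AddCircle (2 * π)) R) = ENNReal.ofReal (2 * π / 3) := by
    apply le_antisymm
    · exact upper h1 h2
    · exact le_iInf₂ fun R hR => lower R hR
  rw [hinf, show (2:ℝ≥0∞) = ENNReal.ofReal 2 by simp, ← ENNReal.ofReal_div_of_pos (by norm_num)]
  congr 1
  ring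
end

section
/- Let S¹ be the unit circle with intrinsic metric and I_λ = [0,λ] ⊆ ℝ. For every λ ≥ 2π, the Gromov–Hausdorff distance equals d_GH(I_λ, S¹) = (λ − π)/2. -/
open Set Metric Real
open scoped ENNReal

lemma circ_dist_le (a b : ℝ) : dist (a : AddCircle (2 * π)) (b : AddCircle (2 * π)) ≤ |a - b| := by
  rw [dist_eq_norm, ← AddCircle.coe_sub]
  exact QuotientAddGroup.norm_mk_le_norm

lemma circ_dist_le_pi (a b : AddCircle (2 * π)) : dist a b ≤ π := by
  rw [dist_eq_norm]
  have h := AddCircle.norm_le_half_period (2 * π) (x := a - b) (by positivity)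
  rw [abs_of_pos (by positivity)] at h
  linarith

lemma circ_dist_pi : dist ((0:ℝ) : AddCircle (2 * π)) ((π:ℝ) : AddCircle (2 * π)) = π := by
  have hp := Real.pi_pos
  rw [dist_comm, dist_eq_norm, ← AddCircle.coe_sub, sub_zero]
  have h : |π| ≤ |2 * π| / 2 := by
    rw [abs_of_pos hp, abs_of_pos (by positivity)]
    linarith
  rw [(AddCircle.norm_coe_eq_abs_iff (2 * π) (by positivity)).2 h, abs_of_pos hp]

lemma circ_cross (x s : ℝ) (hx : 0 ≤ x) (hs : 0 ≤ s) :
    π - s - x ≤ dist (x : AddCircle (2 * π)) ((π + s : ℝ) : AddCircle (2 * π)) := by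
  have h1 := dist_triangle4 ((0:ℝ) : AddCircle (2 * π)) (x : AddCircle (2 * π))
    ((π + s : ℝ) : AddCircle (2 * π)) ((π : ℝ) : AddCircle (2 * π))
  rw [circ_dist_pi] at h1
  have h2 := circ_dist_le 0 x
  have h3 := circ_dist_le (π + s) π
  rw [zero_sub, abs_neg, abs_of_nonneg hx] at h2
  rw [add_sub_cancel_left, abs_of_nonneg hs] at h3
  linarith

/-- The optimal correspondence. -/
def segRel (lam : ℝ) : Set (↥(Set.Icc (0:ℝ) lam) × AddCircle (2 * π)) :=
  {p | ((p.1 : ℝ) ≤ π ∧ p.2 = ((p.1 : ℝ) : AddCircle (2 * π))) ∨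
    (lam - π ≤ (p.1 : ℝ) ∧ p.2 = ((π + (lam - p.1) : ℝ) : AddCircle (2 * π))) ∨
    (π ≤ (p.1 : ℝ) ∧ (p.1 : ℝ) ≤ lam - π)}

lemma segRel_corr {lam : ℝ} (h1 : 2 * π ≤ lam) :
    IsCorrespondence ↥(Set.Icc (0:ℝ) lam) (AddCircle (2 * π)) (segRel lam) := by
  have hp := Real.pi_pos
  constructor
  · intro x
    rcases le_total (x : ℝ) π with h | h
    · exact ⟨((x : ℝ) : AddCircle (2 * π)), Or.inl ⟨h, rfl⟩⟩
    · rcases le_total (lam - π) (x : ℝ) with h' | h'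
      · exact ⟨((π + (lam - x) : ℝ) : AddCircle (2 * π)), Or.inr (Or.inl ⟨h', rfl⟩)⟩
      · exact ⟨0, Or.inr (Or.inr ⟨h, h'⟩)⟩
  · intro y
    haveI : Fact (0 < 2 * π) := ⟨by positivity⟩
    obtain ⟨b, hb, rfl⟩ := AddCircle.eq_coe_Ico y
    rcases le_total b π with h | h
    · exact ⟨⟨b, hb.1, by linarith⟩, Or.inl ⟨h, rfl⟩⟩
    · refine ⟨⟨lam + π - b, by linarith [hb.2], by linarith⟩, Or.inr (Or.inl ⟨?_, ?_⟩)⟩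
      · show lam - π ≤ lam + π - b
        linarith [hb.2]
      · show (b : AddCircle (2 * π)) = ((π + (lam - (lam + π - b)) : ℝ) : AddCircle (2 * π))
        congr 1
        ring

lemma segRel_dis {lam : ℝ} (h1 : 2 * π ≤ lam) (p q : ↥(Set.Icc (0:ℝ) lam) × AddCircle (2 * π))
    (hp : p ∈ segRel lam) (hq : q ∈ segRel lam) :
    |dist p.1 q.1 - dist p.2 q.2| ≤ lam - π := by
  have hpi := Real.pi_pos
  obtain ⟨⟨x, hx0, hx1⟩, y⟩ := p
  obtain ⟨⟨x', hx0', hx1'⟩, y'⟩ := q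
  have hd : dist (⟨x, hx0, hx1⟩ : ↥(Set.Icc (0:ℝ) lam)) ⟨x', hx0', hx1'⟩ = |x - x'| := rfl
  have hle := circ_dist_le_pi y y'
  have hnn : 0 ≤ dist y y' := dist_nonneg
  simp only [segRel, Set.mem_setOf_eq] at hp hq
  simp only [hd]
  rw [abs_le]
  refine ⟨by linarith [abs_nonneg (x - x')], ?_⟩
  rw [sub_le_iff_le_add, abs_le]
  rcases hp with ⟨a, b⟩ | ⟨a, b⟩ | ⟨a, b⟩ <;> rcases hq with ⟨c, d⟩ | ⟨c, d⟩ | ⟨c, d⟩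
  case inl.inr.inl =>
    have h := circ_cross x (lam - x') hx0 (by linarith)
    rw [← b, ← d] at h
    constructor <;> linarith
  case inr.inl.inl =>
    have h := circ_cross x' (lam - x) hx0' (by linarith)
    rw [← b, ← d, dist_comm] at h
    constructor <;> linarith
  all_goals constructor <;> linarith

theorem ghDist_segment_circle_very_large {lam : ℝ} (h1 : 2 * π ≤ lam) :
    ghDist ↥(Set.Icc (0:ℝ) lam) (AddCircle (2 * π)) = ENNReal.ofReal ((lam - π) / 2) := by
  have hpi := Real.pi_pos
  rw [ghDist, ENNReal.ofReal_div_of_pos (by norm_num), ENNReal.ofReal_ofNat]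
  congr 1
  apply le_antisymm
  · refine (iInf₂_le (segRel lam) (segRel_corr h1)).trans ?_
    refine iSup₂_le fun p hp => iSup₂_le fun q hq => ?_
    exact ENNReal.ofReal_le_ofReal (segRel_dis h1 p q hp hq)
  · refine le_iInf₂ fun R hR => ?_
    obtain ⟨y, hy⟩ := hR.1 ⟨0, le_rfl, by linarith⟩
    obtain ⟨y', hy'⟩ := hR.1 ⟨lam, by linarith, le_rfl⟩
    refine le_trans ?_ (le_iSup₂_of_le _ hy (le_iSup₂_of_le _ hy' le_rfl))
    apply ENNReal.ofReal_le_ofReal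
    refine le_trans ?_ (le_abs_self _)
    have hd : dist (⟨0, le_rfl, by linarith⟩ : ↥(Set.Icc (0:ℝ) lam))
      ⟨lam, by linarith, le_rfl⟩ = |0 - lam| := rfl
    have hle := circ_dist_le_pi y y'
    have hl : |0 - lam| = lam := by
      rw [zero_sub, abs_neg, abs_of_nonneg (by linarith)]
    have hd2 := hd.trans hl
    exact (sub_le_sub_left hle lam).trans (sub_le_sub_right hd2.ge _)
end

section
/- Let S¹ be the unit circle with intrinsic metric and I_λ = [0,λ] ⊆ ℝ the segment of length λ ≥ 0. Then the Gromov–Hausdorff distance is given by the piecewise formula: d_GH(I_λ, S¹) = π/2 − λ/4 if 0 ≤ λ ≤ 2π/3; d_GH(I_λ, S¹) = π/3 if 2π/3 ≤ λ ≤ 5π/3; and d_GH(I_λ, S¹) = (λ − π)/2 if λ ≥ 5π/3. -/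
open Set Metric Real
open scoped ENNReal

namespace GHSC

abbrev C := AddCircle (2 * π)

lemma norm_small {r : ℝ} (h : |r| ≤ π) : ‖(r : C)‖ = |r| := by
  have hp := Real.pi_pos
  rw [AddCircle.norm_coe_eq_abs_iff (2 * π) (by positivity)]
  rw [abs_of_pos (by positivity : (0:ℝ) < 2 * π)]
  linarith

lemma coe_sub_two_pi (r : ℝ) : ((r - 2 * π : ℝ) : C) = (r : C) := by
  have := AddCircle.coe_period (2 * π)
  rw [AddCircle.coe_sub, this, sub_zero]

lemma coe_add_two_pi (r : ℝ) : ((r + 2 * π : ℝ) : C) = (r : C) := by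
  have := AddCircle.coe_period (2 * π)
  rw [AddCircle.coe_add, this, add_zero]

lemma norm_mid {r : ℝ} (h : |r| ≤ 2 * π) : ‖(r : C)‖ = min |r| (2 * π - |r|) := by
  have hp := Real.pi_pos
  by_cases h1 : |r| ≤ π
  · rw [norm_small h1, min_eq_left]; linarith
  · push Not at h1
    rw [min_eq_right (by linarith)]
    rcases le_total 0 r with h0 | h0
    · rw [abs_of_nonneg h0] at *
      rw [← coe_sub_two_pi, norm_small, abs_of_nonpos (by linarith)]
      · linarith
      · rw [abs_of_nonpos (by linarith)]; linarith
    · rw [abs_of_nonpos h0] at *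
      rw [← coe_add_two_pi, norm_small, abs_of_nonneg (by linarith)]
      · linarith
      · rw [abs_of_nonneg (by linarith)]; linarith

lemma dist_coe (r s : ℝ) : dist (r : C) (s : C) = ‖((r - s : ℝ) : C)‖ := by
  rw [dist_eq_norm, AddCircle.coe_sub]

lemma norm_le_pi (x : C) : ‖x‖ ≤ π := by
  have hp := Real.pi_pos
  have := AddCircle.norm_le_half_period (2 * π) (x := x) (by positivity)
  rw [abs_of_pos (by positivity : (0:ℝ) < 2 * π)] at this
  linarith

lemma exists_rep (x : C) : ∃ r : ℝ, -π ≤ r ∧ r ≤ π ∧ (r : C) = x := by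
  have hp := Real.pi_pos
  have : Fact (0 < 2 * π) := ⟨by positivity⟩
  have := AddCircle.coe_image_Ico_eq (2 * π) (-π)
  have hx : x ∈ ((↑) '' Ico (-π) (-π + 2 * π) : Set C) := by rw [this]; trivial
  obtain ⟨r, hr, rfl⟩ := hx
  exact ⟨r, hr.1, by linarith [hr.2], rfl⟩

lemma exists_rep' (x : C) : ∃ r : ℝ, 0 ≤ r ∧ r ≤ 2 * π ∧ (r : C) = x := by
  have hp := Real.pi_pos
  have : Fact (0 < 2 * π) := ⟨by positivity⟩
  have := AddCircle.coe_image_Ico_eq (2 * π) 0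
  have hx : x ∈ ((↑) '' Ico 0 (0 + 2 * π) : Set C) := by rw [this]; trivial
  obtain ⟨r, hr, rfl⟩ := hx
  exact ⟨r, hr.1, by linarith [hr.2], rfl⟩

lemma sign_change (f : C → ℝ) (hne : f 0 ≠ f (π : ℝ)) {ε : ℝ} (hε : 0 < ε) :
    ∃ x y : C, dist x y < ε ∧ f x < f (x + (π : ℝ)) ∧ f (y + (π : ℝ)) ≤ f y := by
  by_contra! hcon
  have hcl : IsClopen {x : C | f x < f (x + (π : ℝ))} := by
    constructor
    · rw [← isOpen_compl_iff, Metric.isOpen_iff]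
      intro x hx
      refine ⟨ε, hε, fun y hy hy' => hx ?_⟩
      exact hcon y x (by simpa using hy) hy'
    · rw [Metric.isOpen_iff]
      intro x hx
      refine ⟨ε, hε, fun y hy => ?_⟩
      exact hcon x y (by rw [dist_comm]; simpa using hy) hx
  have h2 : ((π : ℝ) : C) + (π : ℝ) = 0 := by
    rw [← AddCircle.coe_add, ← two_mul]; exact AddCircle.coe_period _
  rcases isClopen_iff.1 hcl with h | h
  · have h0 : (0 : C) ∉ {x : C | f x < f (x + (π : ℝ))} := by rw [h]; simp
    have h1 : ((π : ℝ) : C) ∉ {x : C | f x < f (x + (π : ℝ))} := by rw [h]; simp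
    simp only [mem_ofPred_eq, h2, zero_add, not_lt] at h0 h1
    exact hne (le_antisymm h1 h0)
  · have h0 : (0 : C) ∈ {x : C | f x < f (x + (π : ℝ))} := by rw [h]; simp
    have h1 : ((π : ℝ) : C) ∈ {x : C | f x < f (x + (π : ℝ))} := by rw [h]; simp
    simp only [mem_ofPred_eq, h2, zero_add] at h0 h1
    exact lt_asymm h0 h1

lemma norm_pi : ‖((π : ℝ) : C)‖ = π := by
  have hp := Real.pi_pos
  rw [norm_small] <;> rw [abs_of_pos hp]

lemma lower_core {lam d : ℝ} (f : C → ℝ) (h0 : ∀ x, 0 ≤ f x) (h1 : ∀ x, f x ≤ lam)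
    (hd : ∀ x y, |(|f x - f y|) - dist x y| ≤ d) : 2 * π / 3 ≤ d ∧ π - lam / 2 ≤ d := by
  have hp := Real.pi_pos
  have hl : 0 ≤ lam := (h0 0).trans (h1 0)
  by_cases hdp : π ≤ d
  · constructor <;> linarith
  push Not at hdp
  have key : ∀ ε : ℝ, 0 < ε → 2 * π - 2 * d - ε ≤ lam ∧ 2 * π - 2 * d - ε ≤ d + ε := by
    intro ε hε
    have hdist : ∀ x : C, dist x (x + (π : ℝ)) = π := by
      intro x
      rw [dist_eq_norm, sub_add_cancel_left, norm_neg, norm_pi]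
    have hne : f 0 ≠ f (π : ℝ) := by
      intro h
      have := hd 0 (π : ℝ)
      have h2 := hdist 0
      rw [zero_add] at h2
      rw [h2, h, sub_self, abs_zero, zero_sub, abs_neg, abs_of_pos hp] at this
      linarith
    obtain ⟨x, y, hxy, hx, hy⟩ := sign_change f hne hε
    have e1 := (abs_le.1 (hd x (x + (π : ℝ)))).1
    have e2 := (abs_le.1 (hd y (y + (π : ℝ)))).1
    have e3 := (abs_le.1 (hd x y)).2
    have e4 := (abs_le.1 (hd (x + (π : ℝ)) (y + (π : ℝ)))).2
    have e5 := (abs_le.1 (hd x (y + (π : ℝ)))).1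
    rw [hdist] at e1 e2
    rw [dist_add_right] at e4
    have t1 := dist_triangle_left y (y + (π : ℝ)) x
    rw [hdist] at t1
    rw [abs_of_nonpos (by linarith)] at e1
    rw [abs_of_nonneg (by linarith)] at e2
    have b1 := neg_abs_le (f x - f y)
    have b2 := le_abs_self (f (x + (π : ℝ)) - f (y + (π : ℝ)))
    have := h0 x
    have := h1 y
    have := h0 (y + (π : ℝ))
    have := h1 (x + (π : ℝ))
    rcases le_total (f x) (f (y + (π : ℝ))) with h | h
    · rw [abs_of_nonpos (by linarith)] at e5
      constructor <;> linarith
    · rw [abs_of_nonneg (by linarith)] at e5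
      constructor <;> linarith
  constructor
  · by_contra! h
    have := (key ((2 * π - 3 * d) / 4) (by linarith)).2
    linarith
  · by_contra! h
    have := (key ((2 * π - 2 * d - lam) / 2) (by linarith)).1
    linarith

lemma lower_real {lam d : ℝ} (hl : 0 ≤ lam) (R : Set (↥(Set.Icc (0:ℝ) lam) × C))
    (hR : IsCorrespondence _ _ R)
    (hd : ∀ p ∈ R, ∀ q ∈ R, |dist p.1 q.1 - dist p.2 q.2| ≤ d) :
    2 * π / 3 ≤ d ∧ π - lam / 2 ≤ d ∧ lam - π ≤ d := by
  choose f hf using hR.2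
  have h := lower_core (lam := lam) (d := d) (fun x => (f x : ℝ)) (fun x => (f x).2.1)
    (fun x => (f x).2.2) (fun x y => hd _ (hf x) _ (hf y))
  refine ⟨h.1, h.2, ?_⟩
  obtain ⟨y, hy⟩ := hR.1 ⟨0, le_rfl, hl⟩
  obtain ⟨z, hz⟩ := hR.1 ⟨lam, hl, le_rfl⟩
  have := (abs_le.1 (hd _ hz _ hy)).2
  have h2 : dist z y ≤ π := by rw [dist_eq_norm]; exact norm_le_pi _
  have h3 : dist (⟨lam, hl, le_rfl⟩ : ↥(Set.Icc (0:ℝ) lam)) ⟨0, le_rfl, hl⟩ = lam := by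
    rw [Subtype.dist_eq, Real.dist_eq, sub_zero, abs_of_nonneg hl]
  simp only [h3] at this
  linarith

lemma gh_lower {lam D : ℝ} (hl : 0 ≤ lam)
    (hD : ∀ d : ℝ, 2 * π / 3 ≤ d → π - lam / 2 ≤ d → lam - π ≤ d → D ≤ d) :
    ENNReal.ofReal (D / 2) ≤ ghDist ↥(Set.Icc (0:ℝ) lam) C := by
  unfold ghDist
  rw [ENNReal.ofReal_div_of_pos (by norm_num)]
  simp only [ENNReal.ofReal_ofNat]
  gcongr
  refine le_iInf₂ fun R hR => ?_
  by_contra! hlt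
  have hfin : corDistortion ↥(Set.Icc (0:ℝ) lam) C R ≠ ⊤ := hlt.ne_top
  obtain ⟨a, b, c⟩ := lower_real hl R hR
    (d := (corDistortion ↥(Set.Icc (0:ℝ) lam) C R).toReal) (by
      intro p hp q hq
      rw [← ENNReal.ofReal_le_iff_le_toReal hfin]
      exact le_iSup₂_of_le p hp (le_iSup₂_of_le q hq le_rfl))
  have := hD _ a b c
  rw [← ENNReal.ofReal_toReal hfin] at hlt
  exact absurd (ENNReal.ofReal_le_ofReal this) (not_le.2 hlt)

lemma gh_upper {lam d : ℝ} (R : Set (↥(Set.Icc (0:ℝ) lam) × C))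
    (hR : IsCorrespondence _ _ R)
    (hd : ∀ p ∈ R, ∀ q ∈ R, |dist p.1 q.1 - dist p.2 q.2| ≤ d) :
    ghDist ↥(Set.Icc (0:ℝ) lam) C ≤ ENNReal.ofReal (d / 2) := by
  unfold ghDist
  rw [ENNReal.ofReal_div_of_pos (by norm_num)]
  simp only [ENNReal.ofReal_ofNat]
  gcongr
  refine iInf₂_le_of_le R hR ?_
  exact iSup₂_le fun p hp => iSup₂_le fun q hq => ENNReal.ofReal_le_ofReal (hd p hp q hq)

lemma upper_wrap {lam d c : ℝ} (hs : 2 * π ≤ c * lam) (hc : 0 < c)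
    (hd : ∀ t : ℝ, 0 ≤ t → t ≤ lam → |t - ‖((c * t : ℝ) : C)‖| ≤ d) :
    ghDist ↥(Set.Icc (0:ℝ) lam) C ≤ ENNReal.ofReal (d / 2) := by
  refine gh_upper {p | ((c * (p.1 : ℝ) : ℝ) : C) = p.2} ⟨fun x => ⟨((c * (x : ℝ) : ℝ) : C), rfl⟩, ?_⟩ ?_
  · intro y
    obtain ⟨r, h0, h1, rfl⟩ := exists_rep' y
    refine ⟨⟨r / c, by positivity, ?_⟩, ?_⟩
    · rw [div_le_iff₀ hc]; linarith
    · show ((c * (r / c) : ℝ) : C) = r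
      congr 1; field_simp
  · rintro ⟨x, x'⟩ hx ⟨y, y'⟩ hy
    change ((c * (x : ℝ) : ℝ) : C) = x' at hx
    change ((c * (y : ℝ) : ℝ) : C) = y' at hy
    subst hx hy
    have main : ∀ x y : ↥(Set.Icc (0:ℝ) lam), (y : ℝ) ≤ x →
        |dist x y - dist ((c * (x : ℝ) : ℝ) : C) ((c * (y : ℝ) : ℝ) : C)| ≤ d := by
      intro x y h
      rw [Subtype.dist_eq, Real.dist_eq, abs_of_nonneg (by linarith : (0:ℝ) ≤ x - y), dist_coe,
        ← mul_sub]
      exact hd _ (by linarith) (by linarith [x.2.2, y.2.1])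
    rcases le_total (y : ℝ) x with h | h
    · exact main x y h
    · have := main y x h
      rwa [dist_comm, dist_comm (((c * (y : ℝ) : ℝ) : C))] at this

lemma upper1 {lam : ℝ} (h0 : 0 ≤ lam) (h : lam ≤ 2 * π / 3) :
    ghDist ↥(Set.Icc (0:ℝ) lam) C ≤ ENNReal.ofReal ((π - lam / 2) / 2) := by
  have hp := Real.pi_pos
  rcases h0.eq_or_lt with rfl | hpos
  · refine gh_upper univ ⟨fun x => ⟨0, trivial⟩, fun y => ⟨⟨0, le_rfl, le_rfl⟩, trivial⟩⟩ ?_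
    intro p _ q _
    have : dist p.1 q.1 = 0 := by
      rw [Subtype.dist_eq, Real.dist_eq]
      have := p.1.2.1; have := p.1.2.2; have := q.1.2.1; have := q.1.2.2
      rw [abs_eq_zero]; linarith
    rw [this, zero_sub, abs_neg, abs_of_nonneg dist_nonneg, dist_eq_norm]
    linarith [norm_le_pi (p.2 - q.2)]
  · refine upper_wrap (c := 2 * π / lam) (by rw [div_mul_cancel₀ _ hpos.ne']) (by positivity) ?_
    intro t ht0 ht1
    have hb : 2 * π / lam * t ≤ 2 * π := by
      rw [div_mul_eq_mul_div, div_le_iff₀ hpos]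
      exact mul_le_mul_of_nonneg_left ht1 (by positivity)
    have hn : 0 ≤ 2 * π / lam * t := by positivity
    rw [norm_mid (by rw [abs_of_nonneg hn]; exact hb), abs_of_nonneg hn]
    have hm : 0 ≤ min (2 * π / lam * t) (2 * π - 2 * π / lam * t) := le_min hn (by linarith)
    rw [abs_le]
    constructor
    · rcases le_total t (lam / 2) with h2 | h2
      · have : 2 * π / lam * t - t ≤ π - lam / 2 := by
          have e : π - lam / 2 - (2 * π / lam * t - t) = (2 * π - lam) * (lam / 2 - t) / lam := by
            field_simp
          have : 0 ≤ (2 * π - lam) * (lam / 2 - t) / lam :=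
            div_nonneg (mul_nonneg (by linarith) (by linarith)) hpos.le
          linarith
        linarith [min_le_left (2 * π / lam * t) (2 * π - 2 * π / lam * t)]
      · have : π ≤ 2 * π / lam * t := by
          rw [div_mul_eq_mul_div, le_div_iff₀ hpos]
          nlinarith
        linarith [min_le_right (2 * π / lam * t) (2 * π - 2 * π / lam * t)]
    · linarith

lemma upper2 {lam : ℝ} (h : 2 * π / 3 ≤ lam) (h' : lam ≤ π) :
    ghDist ↥(Set.Icc (0:ℝ) lam) C ≤ ENNReal.ofReal ((2 * π / 3) / 2) := by
  have hp := Real.pi_pos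
  refine upper_wrap (c := 3) (by linarith) (by positivity) ?_
  intro t ht0 ht1
  rcases le_total t (2 * π / 3) with h2 | h2
  · rw [norm_mid (by rw [abs_of_nonneg (by linarith)]; linarith),
      abs_of_nonneg (by linarith : 0 ≤ 3 * t)]
    rw [abs_le]
    rcases le_total (3 * t) (2 * π - 3 * t) with h3 | h3
    · rw [min_eq_left h3]; constructor <;> linarith
    · rw [min_eq_right h3]; constructor <;> linarith
  · rw [← coe_sub_two_pi, norm_small (by rw [abs_of_nonneg (by linarith)]; linarith),
      abs_of_nonneg (by linarith : 0 ≤ 3 * t - 2 * π), abs_le]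
    constructor <;> linarith

/-- parametrised relation, shifted coordinate -/
def Rel (c d T r : ℝ) : Prop :=
  (-(2 * π / 3) ≤ r ∧ r ≤ π / 3 ∧ T = max |r| c) ∨
  (-π ≤ r ∧ r ≤ π ∧ (r ≤ -(2 * π / 3) ∨ π / 3 ≤ r) ∧ T = min |r| (π - c) + d) ∨
  (r = -(π / 3) ∧ 2 * π / 3 ≤ T ∧ T ≤ π / 3 + d)

lemma norm_facts {r s : ℝ} (h1 : -π ≤ r) (h2 : r ≤ π) (h3 : -π ≤ s) (h4 : s ≤ π) :
    |r| - |s| ≤ ‖((r - s : ℝ) : C)‖ ∧ |s| - |r| ≤ ‖((r - s : ℝ) : C)‖ ∧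
    ‖((r - s : ℝ) : C)‖ ≤ |r - s| ∧ ‖((r - s : ℝ) : C)‖ ≤ 2 * π - |r - s| ∧
    ‖((r - s : ℝ) : C)‖ ≤ π := by
  have h : |r - s| ≤ 2 * π := by rw [abs_le]; constructor <;> linarith
  refine ⟨?_, ?_, ?_, ?_, norm_le_pi _⟩ <;> rw [norm_mid h]
  · refine le_min (abs_sub_abs_le_abs_sub _ _) ?_
    rcases abs_cases r with a | a <;> rcases abs_cases s with b | b <;>
      rcases abs_cases (r - s) with e | e <;> linarith
  · refine le_min (by rw [abs_sub_comm r s]; exact abs_sub_abs_le_abs_sub _ _) ?_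
    rcases abs_cases r with a | a <;> rcases abs_cases s with b | b <;>
      rcases abs_cases (r - s) with e | e <;> linarith
  · exact min_le_left _ _
  · exact min_le_right _ _

section
variable {c d p r s m T U : ℝ}

lemma dAA (hp : 0 < p) (hc : 0 ≤ c) (hc' : c ≤ p / 3) (hd : 2 * p / 3 ≤ d)
    (m1 : |r| - |s| ≤ m) (m2 : |s| - |r| ≤ m) (m3 : m ≤ |r - s|)
    (a1 : -(2 * p / 3) ≤ r) (a2 : r ≤ p / 3) (a3 : T = max |r| c)
    (b1 : -(2 * p / 3) ≤ s) (b2 : s ≤ p / 3) (b3 : U = max |s| c) :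
    T - U ≤ m + d ∧ U - T ≤ m + d ∧ m ≤ |T - U| + d := by
  subst a3 b3
  have k1 := le_abs_self (max |r| c - max |s| c)
  have k2 := neg_abs_le (max |r| c - max |s| c)
  rcases max_cases |r| c with x | x <;> rcases max_cases |s| c with y | y <;>
    rcases abs_cases r with a | a <;> rcases abs_cases s with b | b <;>
      rcases abs_cases (r - s) with e | e <;> refine ⟨?_, ?_, ?_⟩ <;> linarith

set_option maxHeartbeats 2000000 in
lemma dBB (hp : 0 < p) (hc : 0 ≤ c) (hc' : c ≤ p / 3) (hd : 2 * p / 3 ≤ d)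
    (m1 : |r| - |s| ≤ m) (m2 : |s| - |r| ≤ m) (m3 : m ≤ |r - s|) (m4 : m ≤ 2 * p - |r - s|)
    (a0 : -p ≤ r) (a1 : r ≤ p) (a2 : r ≤ -(2 * p / 3) ∨ p / 3 ≤ r) (a3 : T = min |r| (p - c) + d)
    (b0 : -p ≤ s) (b1 : s ≤ p) (b2 : s ≤ -(2 * p / 3) ∨ p / 3 ≤ s)
    (b3 : U = min |s| (p - c) + d) :
    T - U ≤ m + d ∧ U - T ≤ m + d ∧ m ≤ |T - U| + d := by
  have k1 := le_abs_self (T - U)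
  have k2 := neg_abs_le (T - U)
  rcases a2 with a2 | a2 <;> rcases b2 with b2 | b2 <;>
  rcases min_cases |r| (p - c) with x | x <;> rcases min_cases |s| (p - c) with y | y <;>
    rcases abs_cases r with a | a <;> rcases abs_cases s with b | b <;>
      rcases abs_cases (r - s) with e | e <;> refine ⟨?_, ?_, ?_⟩ <;> linarith

lemma dAB (hp : 0 < p) (hc : 0 ≤ c) (hc' : c ≤ p / 3) (hd : 2 * p / 3 ≤ d)
    (m1 : |r| - |s| ≤ m) (m2 : |s| - |r| ≤ m) (m3 : m ≤ p)
    (a1 : -(2 * p / 3) ≤ r) (a2 : r ≤ p / 3) (a3 : T = max |r| c)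
    (b0 : -p ≤ s) (b1 : s ≤ p) (b2 : s ≤ -(2 * p / 3) ∨ p / 3 ≤ s)
    (b3 : U = min |s| (p - c) + d) :
    T - U ≤ m + d ∧ U - T ≤ m + d ∧ m ≤ |T - U| + d := by
  have k1 := le_abs_self (T - U)
  have k2 := neg_abs_le (T - U)
  rcases b2 with b2 | b2 <;>
  rcases max_cases |r| c with x | x <;> rcases min_cases |s| (p - c) with y | y <;>
    rcases abs_cases r with a | a <;> rcases abs_cases s with b | b <;>
      refine ⟨?_, ?_, ?_⟩ <;> linarith

lemma dAG (hp : 0 < p) (hc : 0 ≤ c) (hc' : c ≤ p / 3) (hd : 2 * p / 3 ≤ d)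
    (m1 : |r| - |s| ≤ m) (m2 : |s| - |r| ≤ m) (m3 : m ≤ |r - s|)
    (a1 : -(2 * p / 3) ≤ r) (a2 : r ≤ p / 3) (a3 : T = max |r| c)
    (b1 : s = -(p / 3)) (b2 : 2 * p / 3 ≤ U) (b3 : U ≤ p / 3 + d) :
    T - U ≤ m + d ∧ U - T ≤ m + d ∧ m ≤ |T - U| + d := by
  have k1 := le_abs_self (T - U)
  have k2 := neg_abs_le (T - U)
  rcases max_cases |r| c with x | x <;>
    rcases abs_cases r with a | a <;> rcases abs_cases s with b | b <;>
      rcases abs_cases (r - s) with e | e <;> refine ⟨?_, ?_, ?_⟩ <;> linarith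

lemma dBG (hp : 0 < p) (hc : 0 ≤ c) (hc' : c ≤ p / 3) (hd : 2 * p / 3 ≤ d)
    (m1 : |r| - |s| ≤ m) (m2 : |s| - |r| ≤ m) (m3 : m ≤ |r - s|) (m4 : m ≤ p)
    (a0 : -p ≤ r) (a1 : r ≤ p) (a2 : r ≤ -(2 * p / 3) ∨ p / 3 ≤ r) (a3 : T = min |r| (p - c) + d)
    (b1 : s = -(p / 3)) (b2 : 2 * p / 3 ≤ U) (b3 : U ≤ p / 3 + d) :
    T - U ≤ m + d ∧ U - T ≤ m + d ∧ m ≤ |T - U| + d := by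
  have k1 := le_abs_self (T - U)
  have k2 := neg_abs_le (T - U)
  rcases a2 with a2 | a2 <;>
  rcases min_cases |r| (p - c) with x | x <;>
    rcases abs_cases r with a | a <;> rcases abs_cases s with b | b <;>
      rcases abs_cases (r - s) with e | e <;> refine ⟨?_, ?_, ?_⟩ <;> linarith

end

lemma Rel.bd {c d T r : ℝ} (h : Rel c d T r) : -π ≤ r ∧ r ≤ π := by
  have hp := Real.pi_pos
  rcases h with h | h | h
  · constructor <;> linarith [h.1, h.2.1]
  · exact ⟨h.1, h.2.1⟩
  · constructor <;> linarith [h.1]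

lemma Rel.dis {c d T U r s : ℝ} (hc : 0 ≤ c) (hc' : c ≤ π / 3) (hd : 2 * π / 3 ≤ d)
    (h : Rel c d T r) (k : Rel c d U s) :
    |(|T - U|) - ‖((r - s : ℝ) : C)‖| ≤ d := by
  have hp := Real.pi_pos
  obtain ⟨m1, m2, m3, m4, m5⟩ := norm_facts h.bd.1 h.bd.2 k.bd.1 k.bd.2
  have m3' := m3
  rw [abs_sub_comm] at m3'
  suffices H : T - U ≤ ‖((r - s : ℝ) : C)‖ + d ∧ U - T ≤ ‖((r - s : ℝ) : C)‖ + d ∧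
      ‖((r - s : ℝ) : C)‖ ≤ |T - U| + d by
    obtain ⟨h1, h2, h3⟩ := H
    have : |T - U| ≤ ‖((r - s : ℝ) : C)‖ + d := abs_le.2 ⟨by linarith, h1⟩
    rw [abs_le]; constructor <;> linarith
  have sw : (U - T ≤ ‖((r - s : ℝ) : C)‖ + d ∧ T - U ≤ ‖((r - s : ℝ) : C)‖ + d ∧
      ‖((r - s : ℝ) : C)‖ ≤ |U - T| + d) → (T - U ≤ ‖((r - s : ℝ) : C)‖ + d ∧
      U - T ≤ ‖((r - s : ℝ) : C)‖ + d ∧ ‖((r - s : ℝ) : C)‖ ≤ |T - U| + d) := by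
    rintro ⟨h1, h2, h3⟩
    exact ⟨h2, h1, by rwa [abs_sub_comm]⟩
  rcases h with ⟨a1, a2, a3⟩ | ⟨a0, a1, a2, a3⟩ | ⟨a1, a2, a3⟩ <;>
    rcases k with ⟨b1, b2, b3⟩ | ⟨b0, b1, b2, b3⟩ | ⟨b1, b2, b3⟩
  · exact dAA hp hc hc' hd m1 m2 m3 a1 a2 a3 b1 b2 b3
  · exact dAB hp hc hc' hd m1 m2 m5 a1 a2 a3 b0 b1 b2 b3
  · exact dAG hp hc hc' hd m1 m2 m3 a1 a2 a3 b1 b2 b3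
  · exact sw (dAB hp hc hc' hd m2 m1 m5 b1 b2 b3 a0 a1 a2 a3)
  · exact dBB hp hc hc' hd m1 m2 m3 m4 a0 a1 a2 a3 b0 b1 b2 b3
  · exact dBG hp hc hc' hd m1 m2 m3 m5 a0 a1 a2 a3 b1 b2 b3
  · exact sw (dAG hp hc hc' hd m2 m1 m3' b1 b2 b3 a1 a2 a3)
  · exact sw (dBG hp hc hc' hd m2 m1 m3' m5 b0 b1 b2 b3 a1 a2 a3)
  · have k1 := abs_nonneg (T - U)
    have : ‖((r - s : ℝ) : C)‖ ≤ 0 := by simpa [a1, b1] using m3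
    have := norm_nonneg ((r - s : ℝ) : C)
    refine ⟨?_, ?_, ?_⟩ <;> linarith

lemma upper3 {lam c d : ℝ} (hc : 0 ≤ c) (hc' : c ≤ π / 3) (hd : 2 * π / 3 ≤ d)
    (hl : lam = π + d - 2 * c) :
    ghDist ↥(Set.Icc (0:ℝ) lam) C ≤ ENNReal.ofReal (d / 2) := by
  have hp := Real.pi_pos
  refine gh_upper {q | ∃ r : ℝ, Rel c d ((q.1 : ℝ) + c) r ∧ (r : C) = q.2} ⟨?_, ?_⟩ ?_
  · rintro ⟨t, ht0, ht1⟩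
    suffices H : ∃ r, Rel c d (t + c) r by
      obtain ⟨r, hr⟩ := H
      exact ⟨(r : C), r, hr, rfl⟩
    by_cases h1 : t + c ≤ 2 * π / 3
    · refine ⟨-(t + c), Or.inl ⟨by linarith, by linarith, ?_⟩⟩
      rw [abs_neg, abs_of_nonneg (by linarith), max_eq_left (by linarith)]
    · by_cases h2 : t + c ≤ π / 3 + d
      · exact ⟨-(π / 3), Or.inr (Or.inr ⟨rfl, by linarith, h2⟩)⟩
      · refine ⟨t + c - d, Or.inr (Or.inl ⟨by linarith, by linarith, Or.inr (by linarith), ?_⟩)⟩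
        rw [abs_of_nonneg (by linarith), min_eq_left (by linarith)]
        ring
  · intro y
    obtain ⟨r, h0, h1, rfl⟩ := exists_rep y
    suffices H : ∃ T, c ≤ T ∧ T ≤ lam + c ∧ Rel c d T r by
      obtain ⟨T, a, b, h⟩ := H
      refine ⟨⟨T - c, by linarith, by linarith⟩, r, ?_, rfl⟩
      simpa using h
    by_cases hA : -(2 * π / 3) ≤ r ∧ r ≤ π / 3
    · refine ⟨max |r| c, le_max_right _ _, max_le ?_ (by linarith), Or.inl ⟨hA.1, hA.2, rfl⟩⟩
      rw [abs_le]; constructor <;> linarith [hA.1, hA.2]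
    · refine ⟨min |r| (π - c) + d, ?_, ?_, Or.inr (Or.inl ⟨h0, h1, ?_, rfl⟩)⟩
      · have : 0 ≤ min |r| (π - c) := le_min (abs_nonneg _) (by linarith)
        linarith
      · linarith [min_le_right |r| (π - c)]
      · by_contra! h
        exact hA ⟨by linarith, by linarith⟩
  · rintro ⟨x, _⟩ ⟨r, hr, rfl⟩ ⟨y, _⟩ ⟨s, hs, rfl⟩
    have := Rel.dis hc hc' hd hr hs
    rw [add_sub_add_right_eq_sub] at this
    rwa [dist_coe, Subtype.dist_eq, Real.dist_eq]

end GHSC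

theorem ghDist_segment_circle {lam : ℝ} (h0 : 0 ≤ lam) :
    (lam ≤ 2 * π / 3 →
      ghDist ↥(Set.Icc (0:ℝ) lam) (AddCircle (2 * π)) = ENNReal.ofReal (π / 2 - lam / 4)) ∧
    (2 * π / 3 ≤ lam → lam ≤ 5 * π / 3 →
      ghDist ↥(Set.Icc (0:ℝ) lam) (AddCircle (2 * π)) = ENNReal.ofReal (π / 3)) ∧
    (5 * π / 3 ≤ lam →
      ghDist ↥(Set.Icc (0:ℝ) lam) (AddCircle (2 * π)) = ENNReal.ofReal ((lam - π) / 2)) := by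
  have hp := Real.pi_pos
  refine ⟨fun h => ?_, fun h h' => ?_, fun h => ?_⟩
  · rw [show π / 2 - lam / 4 = (π - lam / 2) / 2 by ring]
    exact le_antisymm (GHSC.upper1 h0 h) (GHSC.gh_lower h0 fun d _ h2 _ => h2)
  · rw [show π / 3 = (2 * π / 3) / 2 by ring]
    refine le_antisymm ?_ (GHSC.gh_lower h0 fun d h1 _ _ => h1)
    rcases le_total lam π with h2 | h2
    · exact GHSC.upper2 h h2
    · exact GHSC.upper3 (c := (5 * π / 3 - lam) / 2) (by linarith) (by linarith) le_rfl (by ring)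
  · refine le_antisymm ?_ (GHSC.gh_lower h0 fun d _ _ h3 => h3)
    exact GHSC.upper3 (c := 0) le_rfl (by linarith) (by linarith) (by ring)
end
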